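/- arXiv:2302.12603 — 2 statements merged into one kernel-verified Lean document; each statement's English description precedes it below -/
import Mathlib

section
/- Assume the linear difference equation x_{n+1} = A_n x_n admits no nontrivial bounded solution, q̂ < 1 and L̂ < ∞; for each λ ∈ Σ let (y^λ_n)_{n∈ℤ} be a sequence in X with |y^λ_{n+1} − A_n y^λ_n − f_λ(n, y^λ_n)| ≤ ε_n for all n ∈ ℤ, and let (x^λ_n)_{n∈ℤ} be the unique sequence with x^λ_{n+1} = A_n x^λ_n + f_λ(n, x^λ_n) and |x^λ_n − y^λ_n| ≤ L̂/(1−q̂) for all n. Let k ∈ ℕ and suppose there exists C > 0 such that conditions (D1) and (D2) hold. Then for each n ∈ ℤ the map Σ ∋ λ ↦ x^λ_n is C^k. -/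
open Set

section
open Filter Topology
open scoped BoundedContinuousFunction Nat

section

/-- The function `a`, bundled as a bounded function (junk value `0` if it is unbounded). -/
noncomputable def toBounded {W ι : Type*} [NormedAddCommGroup W] [TopologicalSpace ι]
    [DiscreteTopology ι] (a : ι → W) : ι →ᵇ W :=
  open Classical in
  if h : ∃ K, ∀ i, ‖a i‖ ≤ K then
    BoundedContinuousFunction.ofNormedAddCommGroupDiscrete a h.choose h.choose_spec
  else 0

theorem toBounded_apply {W ι : Type*} [NormedAddCommGroup W] [TopologicalSpace ι]
    [DiscreteTopology ι] {a : ι → W} {K : ℝ} (h : ∀ i, ‖a i‖ ≤ K) (i : ι) :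
    toBounded a i = a i := by
  have h' : ∃ K, ∀ i, ‖a i‖ ≤ K := ⟨K, h⟩
  simp [toBounded, h']

variable {V W ι : Type*} [NormedAddCommGroup V] [NormedSpace ℝ V] [NormedAddCommGroup W]
  [NormedSpace ℝ W]

theorem norm_multilinear_apply_le {n : ℕ} {m : ι → V [×n]→L[ℝ] W} {K : ℝ} (h : ∀ i, ‖m i‖ ≤ K)
    (v : Fin n → V) (i : ι) : ‖m i v‖ ≤ K * ∏ j, ‖v j‖ :=
  (m i).le_of_opNorm_le (h i) v

theorem norm_iteratedFDeriv_sub_le {U : Set V} (hU : IsOpen U) (hconv : Convex ℝ U) {n : ℕ}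
    {h : V → W} (hC : ContDiffOn ℝ (n + 1 : ℕ) h U) {K : ℝ}
    (hK : ∀ v ∈ U, ‖iteratedFDeriv ℝ (n + 1) h v‖ ≤ K) {x y : V} (hx : x ∈ U) (hy : y ∈ U) :
    ‖iteratedFDeriv ℝ n h y - iteratedFDeriv ℝ n h x‖ ≤ K * ‖y - x‖ :=
  hconv.norm_image_sub_le_of_norm_fderiv_le (𝕜 := ℝ)
    (fun v hv => (hC.contDiffAt (hU.mem_nhds hv)).differentiableAt_iteratedFDeriv
      (by exact_mod_cast Nat.lt_succ_self n))
    (fun v hv => by rw [norm_fderiv_iteratedFDeriv]; exact hK v hv) hx hy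

theorem norm_iteratedFDeriv_sub_sub_le {U : Set V} (hU : IsOpen U) (hconv : Convex ℝ U) {n : ℕ}
    {h : V → W} (hC : ContDiffOn ℝ (n + 2 : ℕ) h U) {K : ℝ} (hK0 : 0 ≤ K)
    (hK : ∀ v ∈ U, ‖iteratedFDeriv ℝ (n + 2) h v‖ ≤ K) {x y : V} (hx : x ∈ U) (hy : y ∈ U) :
    ‖iteratedFDeriv ℝ n h y - iteratedFDeriv ℝ n h x
      - (iteratedFDeriv ℝ (n + 1) h x).curryLeft (y - x)‖ ≤ K * ‖y - x‖ * ‖y - x‖ := by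
  have hseg : segment ℝ x y ⊆ U := hconv.segment_subset hx hy
  refine (convex_segment x y).norm_image_sub_le_of_norm_fderiv_le' (𝕜 := ℝ)
    (f := iteratedFDeriv ℝ n h)
    (fun v hv => (hC.contDiffAt (hU.mem_nhds (hseg hv))).differentiableAt_iteratedFDeriv
      (by exact_mod_cast (by omega : n < n + 2))) (fun v hv => ?_)
    (left_mem_segment ℝ x y) (right_mem_segment ℝ x y)
  have h1 : fderiv ℝ (iteratedFDeriv ℝ n h) v - (iteratedFDeriv ℝ (n + 1) h x).curryLeft
      = continuousMultilinearCurryLeftEquiv ℝ (fun _ : Fin (n + 1) => V) W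
        (iteratedFDeriv ℝ (n + 1) h v - iteratedFDeriv ℝ (n + 1) h x) := by
    rw [LinearIsometryEquiv.map_sub, fderiv_iteratedFDeriv]; rfl
  rw [h1, LinearIsometryEquiv.norm_map]
  refine (norm_iteratedFDeriv_sub_le hU hconv hC hK hx (hseg hv)).trans ?_
  gcongr
  exact norm_sub_le_of_mem_segment hv

variable [TopologicalSpace ι]

theorem norm_le_of_forall_apply_le {n : ℕ} {m : V [×n]→L[ℝ] (ι →ᵇ W)} {K : ℝ} (hK : 0 ≤ K)
    (h : ∀ v i, ‖m v i‖ ≤ K * ∏ j, ‖v j‖) : ‖m‖ ≤ K :=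
  ContinuousMultilinearMap.opNorm_le_bound hK fun v =>
    (BoundedContinuousFunction.norm_le
      (mul_nonneg hK (Finset.prod_nonneg fun j _ => norm_nonneg (v j)))).2 (h v)

variable [DiscreteTopology ι]

/-- A bounded family of multilinear maps, as one multilinear map into the bounded families
(junk value `0` if the family is unbounded). -/
noncomputable def multilinearToBounded {n : ℕ} (m : ι → V [×n]→L[ℝ] W) : V [×n]→L[ℝ] (ι →ᵇ W) :=
  open Classical in
  if h : ∃ K, 0 ≤ K ∧ ∀ i, ‖m i‖ ≤ K then
    MultilinearMap.mkContinuous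
      { toFun := fun v => toBounded fun i => m i v
        map_update_add' := fun v j a b => by
          ext i
          obtain ⟨K, -, h⟩ := h
          simp only [BoundedContinuousFunction.coe_add, Pi.add_apply]
          rw [toBounded_apply (norm_multilinear_apply_le h _),
            toBounded_apply (norm_multilinear_apply_le h _),
            toBounded_apply (norm_multilinear_apply_le h _), ContinuousMultilinearMap.map_update_add]
        map_update_smul' := fun v j a b => by
          ext i
          obtain ⟨K, -, h⟩ := h
          simp only [BoundedContinuousFunction.coe_smul]
          rw [toBounded_apply (norm_multilinear_apply_le h _),
            toBounded_apply (norm_multilinear_apply_le h _),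
            ContinuousMultilinearMap.map_update_smul] }
      h.choose fun v => by
        have hK := h.choose_spec
        refine (BoundedContinuousFunction.norm_le
          (mul_nonneg hK.1 (Finset.prod_nonneg fun j _ => norm_nonneg (v j)))).2 fun i => ?_
        simp only [MultilinearMap.coe_mk]
        rw [toBounded_apply (norm_multilinear_apply_le hK.2 _)]
        exact norm_multilinear_apply_le hK.2 _ _
  else 0

theorem multilinearToBounded_apply {n : ℕ} {m : ι → V [×n]→L[ℝ] W} {K : ℝ} (hK : 0 ≤ K)
    (h : ∀ i, ‖m i‖ ≤ K) (v : Fin n → V) (i : ι) : multilinearToBounded m v i = m i v := by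
  have h' : ∃ K, 0 ≤ K ∧ ∀ i, ‖m i‖ ≤ K := ⟨K, hK, h⟩
  simp only [multilinearToBounded, h', dif_pos]
  exact toBounded_apply (norm_multilinear_apply_le h _) i

/-- A family of `C^(k+1)` maps whose derivatives are bounded uniformly in the family is `C^k` as a
map into the space of bounded families. -/
theorem contDiffOn_boundedContinuousFunction {U : Set V} (hU : IsOpen U) (hconv : Convex ℝ U)
    {k : ℕ} {h : ι → V → W} (hC : ∀ i, ContDiffOn ℝ (k + 1 : ℕ) (h i) U) {K : ℝ}
    (hK : ∀ i, ∀ j ≤ k + 1, ∀ v ∈ U, ‖iteratedFDeriv ℝ j (h i) v‖ ≤ K) {H : V → ι →ᵇ W}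
    (hH : ∀ v ∈ U, ∀ i, H v i = h i v) : ContDiffOn ℝ k H U := by
  wlog hK0 : 0 ≤ K generalizing K
  · exact this (K := max K 0)
      (fun i j hj v hv => (hK i j hj v hv).trans (le_max_left _ _)) (le_max_right _ _)
  have key : ∀ j ≤ k + 1, ∀ v ∈ U, ∀ w i,
      multilinearToBounded (fun i => iteratedFDeriv ℝ j (h i) v) w i
        = iteratedFDeriv ℝ j (h i) v w :=
    fun j hj v hv => multilinearToBounded_apply hK0 (fun i => hK i j hj v hv)
  refine HasFTaylorSeriesUpToOn.contDiffOn
    (f' := fun v j => multilinearToBounded fun i => iteratedFDeriv ℝ j (h i) v) ⟨?_, ?_, ?_⟩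
  · intro v hv
    ext i
    rw [hH v hv, ContinuousMultilinearMap.curry0, key 0 (by omega) v hv]
    rfl
  · intro m hm x hx
    have hm : m < k := by exact_mod_cast hm
    refine HasFDerivAt.hasFDerivWithinAt (.of_isLittleO ?_)
    have : (fun y => multilinearToBounded (fun i => iteratedFDeriv ℝ m (h i) y)
        - multilinearToBounded (fun i => iteratedFDeriv ℝ m (h i) x)
        - (multilinearToBounded (fun i => iteratedFDeriv ℝ (m + 1) (h i) x)).curryLeft (y - x))
        =O[𝓝 x] fun y => ‖y - x‖ ^ 2 := by
      refine Asymptotics.IsBigO.of_bound K ?_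
      filter_upwards [hU.mem_nhds hx] with y hy
      rw [norm_pow, norm_norm, pow_two, ← mul_assoc]
      refine norm_le_of_forall_apply_le (by positivity) fun w i => ?_
      have := norm_iteratedFDeriv_sub_sub_le hU hconv
        ((hC i).of_le (by exact_mod_cast (by omega : m + 2 ≤ k + 1))) hK0
        (fun v hv => hK i (m + 2) (by omega) v hv) hx hy
      refine le_trans (le_of_eq ?_) (ContinuousMultilinearMap.le_of_opNorm_le this w)
      simp only [sub_apply, BoundedContinuousFunction.coe_sub,
        Pi.sub_apply, ContinuousMultilinearMap.curryLeft_apply]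
      rw [key m (by omega) y hy, key m (by omega) x hx, key (m + 1) (by omega) x hx]
    refine this.trans_isLittleO ?_
    have h2 := (Asymptotics.isLittleO_pow_id (𝕜 := ℝ) (n := 2) (by norm_num)).comp_tendsto
      (show Tendsto (fun y => ‖y - x‖) (𝓝 x) (𝓝 0) by
        simpa using (continuous_id.sub continuous_const).norm.tendsto' x 0 (by simp))
    exact h2.trans_isBigO (Asymptotics.IsBigO.of_bound 1 (by simp))
  · intro m hm
    have hm : m ≤ k := by exact_mod_cast hm
    refine (LipschitzOnWith.of_dist_le_mul (K := ⟨K, hK0⟩) fun x hx y hy => ?_).continuousOn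
    rw [dist_eq_norm, dist_eq_norm]
    refine norm_le_of_forall_apply_le (by positivity) fun w i => ?_
    refine le_trans (le_of_eq ?_) (ContinuousMultilinearMap.le_of_opNorm_le
      (norm_iteratedFDeriv_sub_le hU hconv
        ((hC i).of_le (by exact_mod_cast (by omega : m + 1 ≤ k + 1)))
        (fun v hv => hK i (m + 1) (by omega) v hv) hy hx) w)
    simp only [sub_apply, BoundedContinuousFunction.coe_sub, Pi.sub_apply]
    rw [key m (by omega) y hy, key m (by omega) x hx]
end

section
variable {E Z : Type*} [NormedAddCommGroup E] [NormedSpace ℝ E] [NormedAddCommGroup Z]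
  [NormedSpace ℝ Z]

theorem norm_fderiv_comp_inr_le {Φ : E × Z → Z} {O : Set Z} (hO : IsOpen O) {q : ℝ} {a : E} {b : Z}
    (hb : b ∈ O) (hq0 : 0 ≤ q) (hΦ : DifferentiableAt ℝ Φ (a, b))
    (hlip : ∀ ζ ∈ O, ∀ ξ ∈ O, ‖Φ (a, ζ) - Φ (a, ξ)‖ ≤ q * ‖ζ - ξ‖) :
    ‖(fderiv ℝ Φ (a, b)).comp (.inr ℝ E Z)‖ ≤ q := by
  have h : HasFDerivAt (fun ζ => Φ (a, ζ)) ((fderiv ℝ Φ (a, b)).comp (.inr ℝ E Z)) b :=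
    hΦ.hasFDerivAt.comp b (hasFDerivAt_prodMk_right a b)
  exact h.le_of_lip' hq0 (by filter_upwards [hO.mem_nhds hb] with ζ hζ using hlip ζ hζ b hb)

theorem contDiffOn_fixedPoint_aux [CompleteSpace Z] {Φ : E × Z → Z} {S : Set E} (hS : IsOpen S)
    {O : Set Z} (hO : IsOpen O) {q : ℝ} (hq0 : 0 ≤ q) (hq1 : q < 1)
    (hΦ : DifferentiableOn ℝ Φ (S ×ˢ O))
    (hlip : ∀ a ∈ S, ∀ ζ ∈ O, ∀ ξ ∈ O, ‖Φ (a, ζ) - Φ (a, ξ)‖ ≤ q * ‖ζ - ξ‖)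
    {z : E → Z} (hzO : ∀ a ∈ S, z a ∈ O) (hz : ∀ a ∈ S, z a = Φ (a, z a)) {a : E} (ha : a ∈ S) :
    HasFDerivAt z ((Ring.inverse (1 - (fderiv ℝ Φ (a, z a)).comp (.inr ℝ E Z))).comp
      ((fderiv ℝ Φ (a, z a)).comp (.inl ℝ E Z))) a := by
  have hΦa : DifferentiableAt ℝ Φ (a, z a) :=
    (hΦ _ ⟨ha, hzO a ha⟩).differentiableAt ((hS.prod hO).mem_nhds ⟨ha, hzO a ha⟩)
  set D := fderiv ℝ Φ (a, z a) with hD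
  have hunit : IsUnit (1 - D.comp (.inr ℝ E Z)) := isUnit_one_sub_of_norm_lt_one
    ((norm_fderiv_comp_inr_le hO (hzO a ha) hq0 hΦa (hlip a ha)).trans_lt hq1)
  have hpart : HasFDerivAt (fun b => Φ (b, z a)) (D.comp (.inl ℝ E Z)) a :=
    hΦa.hasFDerivAt.comp a (hasFDerivAt_prodMk_left a (z a))
  have hbig : (fun b => z b - z a) =O[𝓝 a] fun b => b - a := by
    refine Asymptotics.IsBigO.trans (Asymptotics.IsBigO.of_bound (1 - q)⁻¹ ?_) hpart.isBigO_sub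
    filter_upwards [hS.mem_nhds ha] with b hb
    rw [inv_mul_eq_div, le_div_iff₀ (by linarith)]
    have h1 : ‖z b - z a‖ ≤ ‖Φ (b, z b) - Φ (b, z a)‖ + ‖Φ (b, z a) - Φ (a, z a)‖ := by
      rw [← hz b hb, ← hz a ha]; exact norm_sub_le_norm_sub_add_norm_sub _ _ _
    have h2 := hlip b hb _ (hzO b hb) _ (hzO a ha)
    linarith
  have hcont : Tendsto z (𝓝 a) (𝓝 (z a)) := by
    have : Tendsto (fun b => b - a) (𝓝 a) (𝓝 0) := by
      exact (continuous_id.sub (continuous_const (y := a))).tendsto' a 0 (by simp)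
    simpa using (hbig.trans_tendsto this).add_const (z a)
  have hlit : (fun b => Φ (b, z b) - Φ (a, z a) - D ((b, z b) - (a, z a)))
      =o[𝓝 a] fun b => b - a := by
    have h := hΦa.hasFDerivAt.isLittleO.comp_tendsto (tendsto_id.prodMk_nhds hcont)
    exact h.trans_isBigO ((Asymptotics.isBigO_refl _ _).prod_left hbig)
  refine .of_isLittleO ?_
  refine Asymptotics.IsBigO.trans_isLittleO (Asymptotics.IsBigO.of_bound
    ‖Ring.inverse (1 - D.comp (.inr ℝ E Z))‖ ?_) hlit
  filter_upwards [hS.mem_nhds ha] with b hb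
  refine le_trans (le_of_eq ?_) (ContinuousLinearMap.le_opNorm _ _)
  congr 1
  have h1 : Φ (b, z b) - Φ (a, z a) - D ((b, z b) - (a, z a))
      = (1 - D.comp (.inr ℝ E Z)) (z b - z a) - D.comp (.inl ℝ E Z) (b - a) := by
    have h2 : ((b, z b) - (a, z a) : E × Z) = (b - a, 0) + (0, z b - z a) := by simp
    rw [← hz b hb, ← hz a ha, h2, map_add]
    simp
    abel
  have h3 : ∀ v, Ring.inverse (1 - D.comp (.inr ℝ E Z)) ((1 - D.comp (.inr ℝ E Z)) v) = v :=
    fun v => by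
      exact DFunLike.congr_fun (Ring.inverse_mul_cancel _ hunit) v
  rw [h1, ContinuousLinearMap.map_sub (Ring.inverse _), h3]
  rfl

/-- The fixed point of a `C^k` family of uniform contractions depends in a `C^k` way on the
parameter. -/
theorem contDiffOn_fixedPoint [CompleteSpace Z] {Φ : E × Z → Z} {S : Set E} (hS : IsOpen S)
    {O : Set Z} (hO : IsOpen O) {q : ℝ} (hq0 : 0 ≤ q) (hq1 : q < 1) {k : ℕ} (hk : 1 ≤ k)
    (hΦ : ContDiffOn ℝ k Φ (S ×ˢ O))
    (hlip : ∀ a ∈ S, ∀ ζ ∈ O, ∀ ξ ∈ O, ‖Φ (a, ζ) - Φ (a, ξ)‖ ≤ q * ‖ζ - ξ‖)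
    {z : E → Z} (hzO : ∀ a ∈ S, z a ∈ O) (hz : ∀ a ∈ S, z a = Φ (a, z a)) :
    ContDiffOn ℝ k z S := by
  have hd : DifferentiableOn ℝ Φ (S ×ˢ O) := hΦ.differentiableOn (by exact_mod_cast (by omega : k ≠ 0))
  have hder := fun a (ha : a ∈ S) => contDiffOn_fixedPoint_aux hS hO hq0 hq1 hd hlip hzO hz ha
  have main : ∀ j : ℕ, j ≤ k → ContDiffOn ℝ j z S := by
    intro j
    induction j with
    | zero =>
      intro _
      exact contDiffOn_zero.2 fun a ha => (hder a ha).continuousAt.continuousWithinAt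
    | succ j ih =>
      intro hj
      have hzj := ih (by omega)
      have hΦ' : ContDiffOn ℝ j (fderiv ℝ Φ) (S ×ˢ O) :=
        hΦ.fderiv_of_isOpen (hS.prod hO) (by exact_mod_cast hj)
      have hcomp : ContDiffOn ℝ j (fun a => fderiv ℝ Φ (a, z a)) S :=
        hΦ'.comp (contDiffOn_id.prodMk hzj) fun a ha => ⟨ha, hzO a ha⟩
      push_cast
      rw [contDiffOn_succ_iff_hasFDerivWithinAt_of_uniqueDiffOn hS.uniqueDiffOn]
      refine ⟨by simp, _, ?_, fun a ha => (hder a ha).hasFDerivWithinAt⟩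
      refine ContDiffOn.clm_comp (fun a ha => ?_) (hcomp.clm_comp contDiffOn_const)
      have hunit : IsUnit (1 - (fderiv ℝ Φ (a, z a)).comp (.inr ℝ E Z)) :=
        isUnit_one_sub_of_norm_lt_one ((norm_fderiv_comp_inr_le hO (hzO a ha) hq0
          ((hd _ ⟨ha, hzO a ha⟩).differentiableAt ((hS.prod hO).mem_nhds ⟨ha, hzO a ha⟩))
          (hlip a ha)).trans_lt hq1)
      obtain ⟨u, hu⟩ := hunit
      have h1 := contDiffAt_ringInverse ℝ (n := j) u
      rw [hu] at h1
      exact h1.comp_contDiffWithinAt a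
        ((contDiffOn_const.sub (hcomp.clm_comp contDiffOn_const)) a ha)
  exact main k le_rfl
end

section
variable {V Y W : Type*} [NormedAddCommGroup V] [NormedSpace ℝ V] [NormedAddCommGroup Y]
  [NormedSpace ℝ Y] [NormedAddCommGroup W] [NormedSpace ℝ W]

theorem ContinuousLinearMap.iteratedFDeriv_eq_zero (T : V →L[ℝ] W) {i : ℕ} (hi : 2 ≤ i) (p : V) :
    iteratedFDeriv ℝ i T p = 0 := by
  obtain ⟨i, rfl⟩ := Nat.exists_eq_add_of_le' hi
  have h : fderiv ℝ T = fun _ => T := funext fun x => T.fderiv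
  rw [← norm_eq_zero, ← norm_iteratedFDeriv_fderiv, h, iteratedFDeriv_const_of_ne (by omega)]
  simp

theorem ContinuousLinearMap.norm_iteratedFDeriv_le (T : V →L[ℝ] W) {i : ℕ} (hi : 1 ≤ i) (p : V) :
    ‖iteratedFDeriv ℝ i T p‖ ≤ ‖T‖ := by
  rcases hi.eq_or_lt with rfl | hi
  · rw [norm_iteratedFDeriv_one, T.fderiv]
  · rw [T.iteratedFDeriv_eq_zero hi]; simp

/-- In the formula for the `i`-th derivative of a composition, the terms which involve at least two
derivatives of the outer function are controlled by its derivatives of order at least two. -/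
theorem norm_iteratedFDeriv_comp_sub_le {f : Y → W} {T : Set Y} (hT : IsOpen T) {Ψ : V → Y}
    {U : Set V} (hU : IsOpen U) {i : ℕ} (hf : ContDiffOn ℝ i f T) (hΨ : ContDiffOn ℝ i Ψ U)
    (hmaps : MapsTo Ψ U T) {p : V} (hp : p ∈ U) (hi : 1 ≤ i) {a D : ℝ} (ha : 0 ≤ a)
    (hfa : ∀ j, 2 ≤ j → j ≤ i → ‖iteratedFDeriv ℝ j f (Ψ p)‖ ≤ a)
    (hD : ∀ j, 1 ≤ j → j ≤ i → ‖iteratedFDeriv ℝ j Ψ p‖ ≤ D ^ j) :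
    ‖iteratedFDeriv ℝ i (f ∘ Ψ) p
      - (fderiv ℝ f (Ψ p)).compContinuousMultilinearMap (iteratedFDeriv ℝ i Ψ p)‖
      ≤ i ! * a * D ^ i := by
  set ℓ := fderiv ℝ f (Ψ p)
  set g : Y → W := fun x => f x - ℓ x - (f (Ψ p) - ℓ (Ψ p)) with hg
  have hfp : ContDiffAt ℝ i f (Ψ p) := hf.contDiffAt (hT.mem_nhds (hmaps hp))
  have hΨp : ContDiffAt ℝ i Ψ p := hΨ.contDiffAt (hU.mem_nhds hp)
  have hgC : ContDiffOn ℝ i g T := (hf.sub ℓ.contDiff.contDiffOn).sub contDiffOn_const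
  have hsub : ∀ j, 1 ≤ j → j ≤ i → iteratedFDeriv ℝ j g (Ψ p)
      = iteratedFDeriv ℝ j f (Ψ p) - iteratedFDeriv ℝ j ℓ (Ψ p) := by
    intro j hj1 hj
    have hfj : ContDiffAt ℝ j f (Ψ p) := hfp.of_le (by exact_mod_cast hj)
    rw [hg, fun_iteratedFDeriv_sub_apply (hfj.sub ℓ.contDiff.contDiffAt) contDiffAt_const,
      fun_iteratedFDeriv_sub_apply hfj ℓ.contDiff.contDiffAt,
      iteratedFDeriv_const_of_ne (by omega)]
    simp
  have hgb : ∀ j ≤ i, ‖iteratedFDeriv ℝ j g (Ψ p)‖ ≤ a := by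
    intro j hj
    match j with
    | 0 => simpa [hg] using ha
    | 1 =>
      have hd : DifferentiableAt ℝ f (Ψ p) :=
        hfp.differentiableAt (by exact_mod_cast (by omega : i ≠ 0))
      have : fderiv ℝ g (Ψ p) = 0 := by
        simp only [hg, fderiv_sub_const]
        rw [fderiv_fun_sub hd ℓ.differentiableAt, ℓ.fderiv, sub_self]
      rw [norm_iteratedFDeriv_one, this]
      simpa using ha
    | j + 2 =>
      rw [hsub _ (by omega) hj, ℓ.iteratedFDeriv_eq_zero (by omega), sub_zero]
      exact hfa _ (by omega) hj
  have hcomp := norm_iteratedFDerivWithin_comp_le hgC hΨ le_rfl hT.uniqueDiffOn hU.uniqueDiffOn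
    hmaps hp (C := a) (D := D)
    (fun j hj => by rw [iteratedFDerivWithin_of_isOpen j hT (hmaps hp)]; exact hgb j hj)
    (fun j hj1 hj => by rw [iteratedFDerivWithin_of_isOpen j hU hp]; exact hD j hj1 hj)
  rw [iteratedFDerivWithin_of_isOpen i hU hp] at hcomp
  convert hcomp using 2
  have hfΨ : ContDiffAt ℝ i (fun x => f (Ψ x)) p := hfp.comp p hΨp
  have hℓΨ : ContDiffAt ℝ i (fun x => ℓ (Ψ x)) p := ℓ.contDiff.contDiffAt.comp p hΨp
  have : g ∘ Ψ = fun x => f (Ψ x) - ℓ (Ψ x) - (f (Ψ p) - ℓ (Ψ p)) := rfl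
  rw [this, fun_iteratedFDeriv_sub_apply (hfΨ.sub hℓΨ) contDiffAt_const,
    fun_iteratedFDeriv_sub_apply hfΨ hℓΨ, iteratedFDeriv_const_of_ne (by omega), Pi.zero_apply,
    sub_zero, ← ℓ.iteratedFDeriv_comp_left hΨp le_rfl]
  rfl

theorem norm_iteratedFDeriv_comp_fst_le {r : V → W} {S : Set V} (hS : IsOpen S) {i : ℕ}
    (hr : ContDiffOn ℝ i r S) {p : V × Y} (hp : p.1 ∈ S) :
    ‖iteratedFDeriv ℝ i (fun v : V × Y => r v.1) p‖ ≤ ‖iteratedFDeriv ℝ i r p.1‖ := by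
  have hS' : IsOpen (ContinuousLinearMap.fst ℝ V Y ⁻¹' S) :=
    hS.preimage (ContinuousLinearMap.fst ℝ V Y).continuous
  have h := (ContinuousLinearMap.fst ℝ V Y).iteratedFDerivWithin_comp_right hr hS.uniqueDiffOn
    hS'.uniqueDiffOn (x := p) hp le_rfl
  rw [iteratedFDerivWithin_of_isOpen i hS' (x := p) hp] at h
  rw [← iteratedFDerivWithin_of_isOpen i hS hp]
  refine (congrArg norm h).trans_le
    ((ContinuousMultilinearMap.norm_compContinuousLinearMap_le _ _).trans ?_)
  refine mul_le_of_le_one_right (norm_nonneg _) (Finset.prod_le_one (fun _ _ => norm_nonneg _)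
    fun _ _ => ContinuousLinearMap.norm_fst_le ..)
end

section
variable {E X Z : Type*} [NormedAddCommGroup E] [NormedSpace ℝ E] [NormedAddCommGroup X]
  [NormedSpace ℝ X] [NormedAddCommGroup Z] [NormedSpace ℝ Z]

/-- Derivative bounds for the nonlinearity `f(λ, y(λ) + ζ) + A y(λ) - η(λ)` of the equation for the
deviation `ζ` from the approximate solution `y`, with `η` the shifted term of that solution. -/
theorem norm_iteratedFDeriv_deviation_le {S : Set E} (hS : IsOpen S) {f : E × X → X} {y y' : E → X}
    {A : X →L[ℝ] X} {k : ℕ} (hk : 1 ≤ k) {c a M R : ℝ} (ha : 0 ≤ a) (hM0 : 0 ≤ M) (hc : 0 ≤ c)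
    (hf : ContDiffOn ℝ (k + 1 : ℕ) f (S ×ˢ univ))
    (hy : ContDiffOn ℝ (k + 1 : ℕ) y S) (hy' : ContDiffOn ℝ (k + 1 : ℕ) y' S)
    (hlip : ∀ l ∈ S, ∀ ξ η, ‖f (l, ξ) - f (l, η)‖ ≤ c * ‖ξ - η‖)
    (hfb : ∀ j, 2 ≤ j → j ≤ k + 1 → ∀ l ∈ S, ∀ ξ, ‖iteratedFDeriv ℝ j f (l, ξ)‖ ≤ a)
    (hyb : ∀ j, 1 ≤ j → j ≤ k + 1 → ∀ l ∈ S, ‖iteratedFDeriv ℝ j y l‖ ≤ M)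
    (hyy : ∀ j, 1 ≤ j → j ≤ k + 1 → ∀ l ∈ S, ‖iteratedFDeriv ℝ j y' l
      - A.compContinuousMultilinearMap (iteratedFDeriv ℝ j y l)
      - iteratedFDeriv ℝ j (fun l => f (l, y l)) l‖ ≤ a)
    {e : Z →L[ℝ] X} (he : ‖e‖ ≤ 1) {l : E} (hl : l ∈ S) {ζ : Z} (hζ : ‖ζ‖ ≤ R)
    {i : ℕ} (hi1 : 1 ≤ i) (hi : i ≤ k + 1) :
    ‖iteratedFDeriv ℝ i (fun p : E × Z => f (p.1, y p.1 + e p.2) + A (y p.1) - y' p.1) (l, ζ)‖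
      ≤ a * (1 + (2 * (k + 1)! + R) * (2 + M) ^ (k + 1)) + c := by
  have hik : ((i : ℕ) : WithTop ℕ∞) ≤ (k + 1 : ℕ) := by exact_mod_cast hi
  have hST : IsOpen (S ×ˢ (univ : Set X)) := hS.prod isOpen_univ
  have hSZ : IsOpen (S ×ˢ (univ : Set Z)) := hS.prod isOpen_univ
  have hp : (l, ζ) ∈ S ×ˢ (univ : Set Z) := ⟨hl, mem_univ _⟩
  have hR : 0 ≤ R := (norm_nonneg _).trans hζ
  have hfst : MapsTo Prod.fst (S ×ˢ (univ : Set Z)) S := fun p hp => hp.1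
  let γ : E → E × X := fun l => (l, y l)
  let ψ : E × Z → E × X := fun p => γ p.1
  let T : E × Z →L[ℝ] E × X := (ContinuousLinearMap.inr ℝ E X).comp (e.comp (.snd ℝ E Z))
  let Ψ : E × Z → E × X := fun p => ψ p + T p
  have hΨ_eq : ∀ p, Ψ p = (p.1, y p.1 + e p.2) := fun p => by simp [Ψ, ψ, γ, T]
  have hT1 : ‖T‖ ≤ 1 := by
    refine (ContinuousLinearMap.opNorm_le_bound _ zero_le_one fun p => ?_)
    have : ‖T p‖ = ‖e p.2‖ := by simp [T]
    rw [this, one_mul]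
    exact (e.le_of_opNorm_le he _).trans (by rw [one_mul]; exact norm_snd_le p)
  have hγC : ContDiffOn ℝ (k + 1 : ℕ) γ S := contDiffOn_id.prodMk hy
  have hψC : ContDiffOn ℝ (k + 1 : ℕ) ψ (S ×ˢ univ) := hγC.comp contDiff_fst.contDiffOn hfst
  have hΨC : ContDiffOn ℝ (k + 1 : ℕ) Ψ (S ×ˢ univ) := hψC.add T.contDiff.contDiffOn
  have hψm : MapsTo ψ (S ×ˢ univ) (S ×ˢ univ) := fun p hp => ⟨hp.1, mem_univ _⟩
  have hΨm : MapsTo Ψ (S ×ˢ univ) (S ×ˢ univ) := fun p hp => by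
    rw [hΨ_eq]; exact ⟨hp.1, mem_univ _⟩
  have hγb : ∀ j, 1 ≤ j → j ≤ k + 1 → ‖iteratedFDeriv ℝ j γ l‖ ≤ 1 + M := by
    intro j hj1 hj
    have hγ_eq : γ = fun l => ContinuousLinearMap.inl ℝ E X l + ContinuousLinearMap.inr ℝ E X (y l) := by
      ext l <;> simp [γ]
    have hyj : ContDiffAt ℝ j y l :=
      (hy.contDiffAt (hS.mem_nhds hl)).of_le (by exact_mod_cast hj)
    rw [hγ_eq, fun_iteratedFDeriv_add_apply (ContinuousLinearMap.contDiff _).contDiffAt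
      (g := fun l => ContinuousLinearMap.inr ℝ E X (y l))
      ((ContinuousLinearMap.contDiff _).contDiffAt.comp l hyj)]
    refine (norm_add_le _ _).trans (add_le_add ?_ ?_)
    · exact (ContinuousLinearMap.norm_iteratedFDeriv_le _ hj1 _).trans
        (ContinuousLinearMap.norm_inl_le_one ..)
    · refine ((ContinuousLinearMap.inr ℝ E X).norm_iteratedFDeriv_comp_left hyj le_rfl).trans ?_
      exact (mul_le_of_le_one_left (norm_nonneg _)
        (ContinuousLinearMap.norm_inr_le_one ..)).trans (hyb j hj1 hj l hl)
  have hψb : ∀ j, 1 ≤ j → j ≤ k + 1 → ‖iteratedFDeriv ℝ j ψ (l, ζ)‖ ≤ 1 + M := fun j hj1 hj =>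
    (norm_iteratedFDeriv_comp_fst_le hS (hγC.of_le (by exact_mod_cast hj)) hl).trans
      (hγb j hj1 hj)
  have hΨ_sub : iteratedFDeriv ℝ i Ψ (l, ζ) - iteratedFDeriv ℝ i ψ (l, ζ)
      = iteratedFDeriv ℝ i T (l, ζ) := by
    rw [fun_iteratedFDeriv_add_apply
      ((hψC.contDiffAt (hSZ.mem_nhds hp)).of_le hik)
      T.contDiff.contDiffAt, add_sub_cancel_left]
  have hΨb : ∀ j, 1 ≤ j → j ≤ k + 1 → ‖iteratedFDeriv ℝ j Ψ (l, ζ)‖ ≤ 2 + M := by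
    intro j hj1 hj
    rw [fun_iteratedFDeriv_add_apply
      ((hψC.contDiffAt (hSZ.mem_nhds hp)).of_le (by exact_mod_cast hj)) T.contDiff.contDiffAt]
    refine (norm_add_le _ _).trans ?_
    have := hψb j hj1 hj
    have := (T.norm_iteratedFDeriv_le hj1 (l, ζ)).trans hT1
    linarith
  have hpow : ∀ {b : ℝ} {j : ℕ}, b ≤ 2 + M → 1 ≤ j → b ≤ (2 + M) ^ j := fun hb hj =>
    hb.trans (le_self_pow₀ (by linarith) (by omega))
  have e1 := norm_iteratedFDeriv_comp_sub_le hST hSZ (hf.of_le hik) (hΨC.of_le hik) hΨm hp hi1 ha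
    (fun j hj1 hj => by rw [hΨ_eq]; exact hfb j hj1 (hj.trans hi) l hl _)
    (fun j hj1 hj => hpow (hΨb j hj1 (hj.trans hi)) hj1)
  have e2 := norm_iteratedFDeriv_comp_sub_le hST hSZ (hf.of_le hik) (hψC.of_le hik) hψm hp hi1 ha
    (fun j hj1 hj => hfb j hj1 (hj.trans hi) l hl _)
    (fun j hj1 hj => hpow ((hψb j hj1 (hj.trans hi)).trans (by linarith)) hj1)
  have e3 : ‖(fderiv ℝ f (Ψ (l, ζ)) - fderiv ℝ f (ψ (l, ζ))).compContinuousMultilinearMap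
      (iteratedFDeriv ℝ i ψ (l, ζ))‖ ≤ a * R * (2 + M) ^ i := by
    refine (ContinuousLinearMap.norm_compContinuousMultilinearMap_le _ _).trans ?_
    refine mul_le_mul ?_ (hpow ((hψb i hi1 hi).trans (by linarith)) hi1) (norm_nonneg _)
      (by positivity)
    have hconv : Convex ℝ (({l} : Set E) ×ˢ (univ : Set X)) :=
      (convex_singleton l).prod convex_univ
    have hdf : ∀ v ∈ ({l} : Set E) ×ˢ (univ : Set X), DifferentiableAt ℝ (fderiv ℝ f) v := by
      rintro ⟨l', ξ⟩ ⟨h1, -⟩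
      obtain rfl : l' = l := h1
      have := (hf.contDiffAt (hST.mem_nhds (x := (l', ξ)) ⟨hl, mem_univ ξ⟩)).fderiv_right
        (m := k) (by exact_mod_cast le_rfl)
      exact this.differentiableAt (by exact_mod_cast (by omega : k ≠ 0))
    have hb : ∀ v ∈ ({l} : Set E) ×ˢ (univ : Set X), ‖fderiv ℝ (fderiv ℝ f) v‖ ≤ a := by
      rintro ⟨l', ξ⟩ ⟨h1, -⟩
      obtain rfl : l' = l := h1
      rw [← norm_iteratedFDeriv_one, norm_iteratedFDeriv_fderiv]
      exact hfb 2 le_rfl (by omega) _ hl ξ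
    refine (hconv.norm_image_sub_le_of_norm_fderiv_le hdf hb
      (x := ψ (l, ζ)) (y := Ψ (l, ζ)) ⟨rfl, mem_univ _⟩ (by rw [hΨ_eq]; exact ⟨rfl, mem_univ _⟩)).trans ?_
    refine mul_le_mul_of_nonneg_left ?_ ha
    have : Ψ (l, ζ) - ψ (l, ζ) = (0, e ζ) := by simp [Ψ, T]
    rw [this, Prod.norm_mk, norm_zero, max_eq_right (norm_nonneg _)]
    exact ((e.le_of_opNorm_le he ζ).trans (by rw [one_mul])).trans hζ
  have e4 : ‖(fderiv ℝ f (Ψ (l, ζ))).compContinuousMultilinearMap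
      (iteratedFDeriv ℝ i T (l, ζ))‖ ≤ c := by
    rw [← ContinuousLinearMap.iteratedFDeriv_comp_left _ T.contDiff.contDiffAt (n := i) le_rfl]
    have := ((fderiv ℝ f (Ψ (l, ζ))).comp T).norm_iteratedFDeriv_le hi1 (l, ζ)
    refine this.trans ?_
    have hdf : DifferentiableAt ℝ f (l, y l + e ζ) :=
      (hf.contDiffAt (hST.mem_nhds ⟨hl, mem_univ _⟩)).differentiableAt
        (by exact_mod_cast (by omega : k + 1 ≠ 0))
    have hpart : ‖(fderiv ℝ f (l, y l + e ζ)).comp (.inr ℝ E X)‖ ≤ c :=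
      (hdf.hasFDerivAt.comp _ (hasFDerivAt_prodMk_right l (y l + e ζ))).le_of_lip' hc
        (Eventually.of_forall fun ξ => hlip l hl ξ _)
    have hes : ‖e.comp (ContinuousLinearMap.snd ℝ E Z)‖ ≤ 1 :=
      (ContinuousLinearMap.opNorm_comp_le _ _).trans
        (mul_le_one₀ he (norm_nonneg _) (ContinuousLinearMap.norm_snd_le ..))
    rw [hΨ_eq]
    refine (ContinuousLinearMap.opNorm_comp_le
      ((fderiv ℝ f (l, y l + e ζ)).comp (.inr ℝ E X)) (e.comp (.snd ℝ E Z))).trans ?_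
    exact (mul_le_of_le_one_right (norm_nonneg _) hes).trans hpart
  let r : E → X := fun l => y' l - A (y l) - f (l, y l)
  have hfγC : ContDiffOn ℝ (k + 1 : ℕ) (fun l => f (l, y l)) S :=
    hf.comp hγC fun l hl => ⟨hl, mem_univ _⟩
  have hAyC : ContDiffOn ℝ (k + 1 : ℕ) (fun l => A (y l)) S := A.contDiff.comp_contDiffOn hy
  have hrC : ContDiffOn ℝ (k + 1 : ℕ) r S := (hy'.sub hAyC).sub hfγC
  have at_l : ∀ {g : E → X}, ContDiffOn ℝ (k + 1 : ℕ) g S → ContDiffAt ℝ i g l := fun hg =>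
    (hg.contDiffAt (hS.mem_nhds hl)).of_le hik
  have e5 : ‖iteratedFDeriv ℝ i (fun p : E × Z => r p.1) (l, ζ)‖ ≤ a := by
    refine (norm_iteratedFDeriv_comp_fst_le hS (hrC.of_le hik) hl).trans ?_
    refine le_trans (le_of_eq ?_) (hyy i hi1 hi l hl)
    rw [fun_iteratedFDeriv_sub_apply ((at_l hy').sub (at_l hAyC)) (at_l hfγC),
      fun_iteratedFDeriv_sub_apply (at_l hy') (at_l hAyC),
      ← A.iteratedFDeriv_comp_left (at_l hy) le_rfl]
    rfl
  have hF : (fun p : E × Z => f (p.1, y p.1 + e p.2) + A (y p.1) - y' p.1)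
      = fun p => (f ∘ Ψ) p - (f ∘ ψ) p - r p.1 := by
    ext p
    simp only [Function.comp_apply, hΨ_eq, ψ, γ, r]
    abel
  have at_p : ∀ {g : E × Z → X}, ContDiffOn ℝ (k + 1 : ℕ) g (S ×ˢ univ) →
      ContDiffAt ℝ i g (l, ζ) := fun hg => (hg.contDiffAt (hSZ.mem_nhds hp)).of_le hik
  have c1 := at_p (hf.comp hΨC hΨm)
  have c2 := at_p (hf.comp hψC hψm)
  have c3 : ContDiffAt ℝ i (fun p : E × Z => r p.1) (l, ζ) :=
    at_p (hrC.comp contDiff_fst.contDiffOn hfst)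
  rw [hF, fun_iteratedFDeriv_sub_apply (c1.sub c2) c3, fun_iteratedFDeriv_sub_apply c1 c2]
  set D := 2 + M
  have hsplit : ∀ (α β ρ : (E × Z) [×i]→L[ℝ] X) (s s' : E × X →L[ℝ] X)
      (u u' t : (E × Z) [×i]→L[ℝ] (E × X)), u - u' = t →
      α - β - ρ = (α - s.compContinuousMultilinearMap u) - (β - s'.compContinuousMultilinearMap u')
        + (s - s').compContinuousMultilinearMap u' + s.compContinuousMultilinearMap t - ρ := by
    rintro α β ρ s s' u u' t rfl
    ext v
    simp
    abel
  rw [hsplit _ _ _ (fderiv ℝ f (Ψ (l, ζ))) (fderiv ℝ f (ψ (l, ζ))) _ _ _ hΨ_sub]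
  have hfac : ((i ! : ℕ) : ℝ) ≤ (k + 1)! := by exact_mod_cast Nat.factorial_le hi
  have hDpow : D ^ i ≤ D ^ (k + 1) := pow_le_pow_right₀ (by simp only [D]; linarith) hi
  have hD0 : 0 ≤ D := by simp only [D]; linarith
  have b1 : (i ! : ℝ) * a * D ^ i ≤ (k + 1)! * a * D ^ (k + 1) := by gcongr
  have b2 : a * R * D ^ i ≤ a * R * D ^ (k + 1) := by gcongr
  refine (norm_sub_le _ _).trans ?_
  have n1 := norm_add_le (iteratedFDeriv ℝ i (f ∘ Ψ) (l, ζ)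
    - (fderiv ℝ f (Ψ (l, ζ))).compContinuousMultilinearMap (iteratedFDeriv ℝ i Ψ (l, ζ))
    - (iteratedFDeriv ℝ i (f ∘ ψ) (l, ζ)
    - (fderiv ℝ f (ψ (l, ζ))).compContinuousMultilinearMap (iteratedFDeriv ℝ i ψ (l, ζ)))
    + (fderiv ℝ f (Ψ (l, ζ)) - fderiv ℝ f (ψ (l, ζ))).compContinuousMultilinearMap
      (iteratedFDeriv ℝ i ψ (l, ζ))) ((fderiv ℝ f (Ψ (l, ζ))).compContinuousMultilinearMap
      (iteratedFDeriv ℝ i T (l, ζ)))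
  have n2 := norm_add_le (iteratedFDeriv ℝ i (f ∘ Ψ) (l, ζ)
    - (fderiv ℝ f (Ψ (l, ζ))).compContinuousMultilinearMap (iteratedFDeriv ℝ i Ψ (l, ζ))
    - (iteratedFDeriv ℝ i (f ∘ ψ) (l, ζ)
    - (fderiv ℝ f (ψ (l, ζ))).compContinuousMultilinearMap (iteratedFDeriv ℝ i ψ (l, ζ))))
    ((fderiv ℝ f (Ψ (l, ζ)) - fderiv ℝ f (ψ (l, ζ))).compContinuousMultilinearMap
      (iteratedFDeriv ℝ i ψ (l, ζ)))
  have n3 := norm_sub_le (iteratedFDeriv ℝ i (f ∘ Ψ) (l, ζ)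
    - (fderiv ℝ f (Ψ (l, ζ))).compContinuousMultilinearMap (iteratedFDeriv ℝ i Ψ (l, ζ)))
    (iteratedFDeriv ℝ i (f ∘ ψ) (l, ζ)
    - (fderiv ℝ f (ψ (l, ζ))).compContinuousMultilinearMap (iteratedFDeriv ℝ i ψ (l, ζ)))
  linarith
end

section
variable {E X : Type*} [NormedAddCommGroup E] [NormedSpace ℝ E] [NormedAddCommGroup X]
  [NormedSpace ℝ X]

section
variable {g : ℤ → X →L[ℝ] X} {w : ℤ → ℝ} {u : ℤ → X} {b : ℝ}

theorem norm_apply_shift_le (hu : ∀ n, ‖u n‖ ≤ b * w n) (n : ℤ) :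
    ‖g n (u (n - 1))‖ ≤ b * (w (n - 1) * ‖g n‖) := by
  refine ((g n).le_opNorm_of_le (hu (n - 1))).trans (le_of_eq (by ring))

theorem summable_apply_shift [CompleteSpace X] (hw : Summable fun n => w (n - 1) * ‖g n‖)
    (hu : ∀ n, ‖u n‖ ≤ b * w n) : Summable fun n => g n (u (n - 1)) :=
  .of_norm_bounded (hw.mul_left b) (norm_apply_shift_le hu)

theorem norm_tsum_apply_shift_le (hw : Summable fun n => w (n - 1) * ‖g n‖)
    (hu : ∀ n, ‖u n‖ ≤ b * w n) :
    ‖∑' n, g n (u (n - 1))‖ ≤ b * ∑' n, w (n - 1) * ‖g n‖ := by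
  rw [← tsum_mul_left]
  exact tsum_of_norm_bounded (hw.mul_left b).hasSum (norm_apply_shift_le hu)

end

/-- A bounded solution of the inhomogeneous equation is given by the Green function `G`. -/
theorem eq_tsum_green [CompleteSpace X] {A : ℤ → X →L[ℝ] X} {G : ℤ → ℤ → X →L[ℝ] X}
    (hGA : ∀ m n, n ≠ m + 1 → G (m + 1) n = (A m).comp (G m n))
    (hGj : ∀ m, G (m + 1) (m + 1) = (A m).comp (G m (m + 1)) + 1)
    (hnb : ∀ x : ℤ → X, (∀ n, x (n + 1) = A n (x n)) → (∃ M, ∀ n, ‖x n‖ ≤ M) → ∀ n, x n = 0)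
    {w : ℤ → ℝ} {Q : ℝ} (hw : ∀ m, Summable fun n => w (n - 1) * ‖G m n‖)
    (hQ : ∀ m, ∑' n, w (n - 1) * ‖G m n‖ ≤ Q) {u z : ℤ → X} {b B : ℝ} (hb : 0 ≤ b)
    (hu : ∀ n, ‖u n‖ ≤ b * w n) (hz : ∀ n, z (n + 1) = A n (z n) + u n) (hzB : ∀ n, ‖z n‖ ≤ B)
    (m : ℤ) : z m = ∑' n, G m n (u (n - 1)) := by
  refine sub_eq_zero.1 (hnb (fun m => z m - ∑' n, G m n (u (n - 1))) (fun m => ?_)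
    ⟨B + b * Q, fun m => ?_⟩ m)
  · have hs := fun m => summable_apply_shift (hw m) hu
    have hterm : ∀ n, G (m + 1) n (u (n - 1))
        = A m (G m n (u (n - 1))) + if n = m + 1 then u m else 0 := by
      intro n
      split_ifs with h
      · subst h
        rw [hGj]; simp
      · rw [hGA m n h]; simp
    have hsum : Summable fun n : ℤ => if n = m + 1 then u m else 0 :=
      (hasSum_ite_eq (m + 1) (u m)).summable
    simp only [hterm]
    rw [((hs m).mapL (A m)).tsum_add hsum, tsum_ite_eq, ← (A m).map_tsum (hs m), hz, map_sub]
    abel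
  · refine (norm_sub_le _ _).trans (add_le_add (hzB m) ?_)
    exact (norm_tsum_apply_shift_le (hw m) hu).trans (mul_le_mul_of_nonneg_left (hQ m) hb)

/-- The operator on bounded sequences with the weighted Green function `G` as its kernel. -/
theorem exists_green_operator [CompleteSpace X] {G : ℤ → ℤ → X →L[ℝ] X} {w : ℤ → ℝ}
    (hw0 : ∀ n, 0 ≤ w n) {Q : ℝ} (hw : ∀ m, Summable fun n => w (n - 1) * ‖G m n‖)
    (hQ : ∀ m, ∑' n, w (n - 1) * ‖G m n‖ ≤ Q) :
    ∃ T : (ℤ →ᵇ X) →L[ℝ] (ℤ →ᵇ X), ∀ u m, T u m = ∑' n, G m n (w (n - 1) • u (n - 1)) := by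
  have hu : ∀ (u : ℤ →ᵇ X) n, ‖w n • u n‖ ≤ ‖u‖ * w n := fun u n => by
    rw [norm_smul, Real.norm_of_nonneg (hw0 n), mul_comm]
    exact mul_le_mul_of_nonneg_right (u.norm_coe_le_norm n) (hw0 n)
  have hs : ∀ (u : ℤ →ᵇ X) m, Summable fun n => G m n (w (n - 1) • u (n - 1)) := fun u m =>
    summable_apply_shift (u := fun n => w n • u n) (hw m) (hu u)
  have hbd : ∀ (u : ℤ →ᵇ X) m, ‖∑' n, G m n (w (n - 1) • u (n - 1))‖ ≤ Q * ‖u‖ := fun u m => by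
    rw [mul_comm]
    exact (norm_tsum_apply_shift_le (u := fun n => w n • u n) (hw m) (hu u)).trans
      (mul_le_mul_of_nonneg_left (hQ m) (norm_nonneg u))
  have hQ0 : 0 ≤ Q :=
    (tsum_nonneg fun n => mul_nonneg (hw0 (n - 1)) (norm_nonneg (G 0 n))).trans (hQ 0)
  refine ⟨LinearMap.mkContinuous
    { toFun := fun u => toBounded fun m => ∑' n, G m n (w (n - 1) • u (n - 1))
      map_add' := fun u v => ?_
      map_smul' := fun r u => ?_ } Q fun u => ?_, fun u m => ?_⟩
  · ext m
    rw [BoundedContinuousFunction.add_apply, toBounded_apply (hbd _), toBounded_apply (hbd _),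
      toBounded_apply (hbd _), ← (hs u m).tsum_add (hs v m)]
    simp
  · ext m
    rw [RingHom.id_apply, BoundedContinuousFunction.smul_apply, toBounded_apply (hbd _),
      toBounded_apply (hbd _), ← (hs u m).tsum_const_smul]
    simp [smul_comm r]
  · refine (BoundedContinuousFunction.norm_le (by positivity)).2 fun m => ?_
    rw [LinearMap.coe_mk, AddHom.coe_mk, toBounded_apply (hbd _)]
    exact hbd u m
  · exact toBounded_apply (hbd _) m

theorem norm_le_of_lipschitz {W : Type*} [NormedAddCommGroup W] {F : W → W} {c ε R : ℝ}
    (hc : 0 ≤ c) (hlip : ∀ ξ η, ‖F ξ - F η‖ ≤ c * ‖ξ - η‖)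
    (h0 : ‖F 0‖ ≤ ε) {ξ : W} (hξ : ‖ξ‖ ≤ R) : ‖F ξ‖ ≤ ε + c * R := by
  have h1 := hlip ξ 0
  rw [sub_zero] at h1
  have h2 := norm_le_norm_sub_add (F ξ) (F 0)
  have := mul_le_mul_of_nonneg_left hξ hc
  linarith

/-- Regularity in the parameter of the bounded solutions of `z_m = ∑ G(m, n) F_{n-1}(λ, z_{n-1})`,
as elements of the space of bounded sequences. -/
theorem contDiffOn_green_fixedPoint [CompleteSpace X] {G : ℤ → ℤ → X →L[ℝ] X} {S : Set E}
    (hS : IsOpen S) (hconv : Convex ℝ S) {c ε : ℤ → ℝ} (hc0 : ∀ n, 0 ≤ c n) (hε0 : ∀ n, 0 < ε n)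
    {q L : ℝ} (hq1 : q < 1) (hqsum : ∀ m, Summable fun n => c (n - 1) * ‖G m n‖)
    (hq : ∀ m, ∑' n, c (n - 1) * ‖G m n‖ ≤ q) (hLsum : ∀ m, Summable fun n => ε (n - 1) * ‖G m n‖)
    (hL : ∀ m, ∑' n, ε (n - 1) * ‖G m n‖ ≤ L) {k : ℕ} (hk : 1 ≤ k) {F : ℤ → E × X → X}
    (hF : ∀ n, ContDiffOn ℝ (k + 1 : ℕ) (F n) (S ×ˢ univ))
    (hlip : ∀ n, ∀ l ∈ S, ∀ ξ η, ‖F n (l, ξ) - F n (l, η)‖ ≤ c n * ‖ξ - η‖)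
    (hF0 : ∀ n, ∀ l ∈ S, ‖F n (l, 0)‖ ≤ ε n) {R K : ℝ}
    (hK : ∀ n i, 1 ≤ i → i ≤ k + 1 → ∀ l ∈ S, ∀ ζ : ℤ →ᵇ X, ‖ζ‖ ≤ R →
      ‖iteratedFDeriv ℝ i (fun p : E × (ℤ →ᵇ X) => F n (p.1, p.2 n)) (l, ζ)‖ ≤ K * (c n + ε n))
    {z : E → ℤ →ᵇ X} (hzR : ∀ l ∈ S, ‖z l‖ < R)
    (hz : ∀ l ∈ S, ∀ m, z l m = ∑' n, G m n (F (n - 1) (l, z l (n - 1)))) :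
    ContDiffOn ℝ k z S := by
  rcases S.eq_empty_or_nonempty with rfl | ⟨l₀, hl₀⟩
  · exact contDiffOn_empty
  have hR : 0 ≤ R := (norm_nonneg _).trans (hzR l₀ hl₀).le
  have hw0 : ∀ n, 0 < c n + ε n := fun n => add_pos_of_nonneg_of_pos (hc0 n) (hε0 n)
  have hw : ∀ m, Summable fun n => (c (n - 1) + ε (n - 1)) * ‖G m n‖ := fun m => by
    simpa only [add_mul] using (hqsum m).add (hLsum m)
  have hQ : ∀ m, ∑' n, (c (n - 1) + ε (n - 1)) * ‖G m n‖ ≤ q + L := fun m => by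
    simp only [add_mul]
    rw [(hqsum m).tsum_add (hLsum m)]
    exact add_le_add (hq m) (hL m)
  obtain ⟨T, hT⟩ := exists_green_operator (w := fun n => c n + ε n) (fun n => (hw0 n).le) hw hQ
  have hq0 : 0 ≤ q :=
    (tsum_nonneg fun n => mul_nonneg (hc0 (n - 1)) (norm_nonneg (G 0 n))).trans (hq 0)
  let O : Set (ℤ →ᵇ X) := Metric.ball 0 R
  have hO : IsOpen O := Metric.isOpen_ball
  have hOR : ∀ {ζ}, ζ ∈ O → ‖ζ‖ ≤ R := fun h => (mem_ball_zero_iff.1 h).le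
  have hzO : ∀ l ∈ S, z l ∈ O := fun l hl => mem_ball_zero_iff.2 (hzR l hl)
  have hFb : ∀ n, ∀ l ∈ S, ∀ ζ ∈ O, ‖F n (l, ζ n)‖ ≤ (1 + R) * (c n + ε n) := by
    intro n l hl ζ hζ
    refine (norm_le_of_lipschitz (F := fun ξ => F n (l, ξ)) (hc0 n) (hlip n l hl) (hF0 n l hl)
      ((ζ.norm_coe_le_norm n).trans (hOR hζ))).trans ?_
    nlinarith [hc0 n, hε0 n, mul_nonneg (hε0 n).le hR]
  let h : ℤ → E × (ℤ →ᵇ X) → X := fun n p => (c n + ε n)⁻¹ • F n (p.1, p.2 n)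
  have hinv : ∀ n {a : ℝ} {v : ℝ}, v ≤ a * (c n + ε n) → (c n + ε n)⁻¹ * v ≤ a := fun n a v hv => by
    rw [inv_mul_le_iff₀ (hw0 n), mul_comm]; exact hv
  have hnorm : ∀ n, ‖(c n + ε n)⁻¹‖ = (c n + ε n)⁻¹ := fun n =>
    Real.norm_of_nonneg (inv_nonneg.2 (hw0 n).le)
  have hhb : ∀ n, ∀ p ∈ S ×ˢ O, ‖h n p‖ ≤ 1 + R := fun n p hp => by
    rw [norm_smul, hnorm]
    exact hinv n (hFb n _ hp.1 _ hp.2)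
  have hSO : IsOpen (S ×ˢ O) := hS.prod hO
  have hev : ∀ n, ContDiff ℝ (k + 1 : ℕ) (fun p : E × (ℤ →ᵇ X) => (p.1, p.2 n)) := fun n =>
    contDiff_fst.prodMk
      ((BoundedContinuousFunction.evalCLM (β := X) ℝ n).contDiff.comp contDiff_snd)
  have hFC : ∀ n, ContDiffOn ℝ (k + 1 : ℕ) (fun p : E × (ℤ →ᵇ X) => F n (p.1, p.2 n)) (S ×ˢ O) :=
    fun n => (hF n).comp (hev n).contDiffOn fun p hp => ⟨hp.1, mem_univ _⟩
  let H : E × (ℤ →ᵇ X) → ℤ →ᵇ X := fun p => toBounded fun n => h n p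
  have hH : ∀ p ∈ S ×ˢ O, ∀ n, H p n = h n p := fun p hp =>
    toBounded_apply fun n => hhb n p hp
  have hHC : ContDiffOn ℝ k H (S ×ˢ O) := by
    refine contDiffOn_boundedContinuousFunction hSO (hconv.prod (convex_ball _ _))
      (h := h) (K := max (1 + R) K) (fun n => (hFC n).const_smul _) (fun n i hi p hp => ?_) hH
    rcases Nat.eq_zero_or_pos i with rfl | hi0
    · rw [norm_iteratedFDeriv_zero]
      exact (hhb n p hp).trans (le_max_left _ _)
    · have hCi : ContDiffAt ℝ i (fun p : E × (ℤ →ᵇ X) => F n (p.1, p.2 n)) p :=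
        ((hFC n).contDiffAt (hSO.mem_nhds hp)).of_le (by exact_mod_cast hi)
      rw [iteratedFDeriv_const_smul_apply' hCi, norm_smul, hnorm]
      exact (hinv n (hK n i hi0 hi _ hp.1 _ (hOR hp.2))).trans (le_max_right _ _)
  have hTH : ∀ p ∈ S ×ˢ O, ∀ m, T (H p) m = ∑' n, G m n (F (n - 1) (p.1, p.2 (n - 1))) := by
    intro p hp m
    rw [hT]
    congr 1 with n
    rw [hH p hp, smul_inv_smul₀ (hw0 (n - 1)).ne']
  have hs : ∀ l ∈ S, ∀ ζ ∈ O, ∀ m, Summable fun n => G m n (F (n - 1) (l, ζ (n - 1))) :=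
    fun l hl ζ hζ m => summable_apply_shift (g := G m) (w := fun n => c n + ε n) (b := 1 + R)
      (u := fun n => F n (l, ζ n)) (hw m) fun n => hFb n l hl ζ hζ
  refine contDiffOn_fixedPoint (Φ := fun p => T (H p)) hS hO hq0 hq1 hk
    (T.contDiff.comp_contDiffOn hHC) (fun l hl ζ hζ ξ hξ => ?_)
    hzO (fun l hl => ?_)
  · refine (BoundedContinuousFunction.norm_le (by positivity)).2 fun m => ?_
    rw [BoundedContinuousFunction.sub_apply, hTH _ ⟨hl, hζ⟩, hTH _ ⟨hl, hξ⟩,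
      ← (hs l hl ζ hζ m).tsum_sub (hs l hl ξ hξ m)]
    simp only [← map_sub]
    refine (norm_tsum_apply_shift_le (u := fun n => F n (l, ζ n) - F n (l, ξ n))
      (g := G m) (w := c) (b := ‖ζ - ξ‖) (hqsum m) fun n => ?_).trans ?_
    · refine (hlip n l hl _ _).trans ?_
      rw [mul_comm]
      exact mul_le_mul_of_nonneg_right ((ζ - ξ).norm_coe_le_norm n) (hc0 n)
    · rw [mul_comm]
      exact mul_le_mul_of_nonneg_right (hq m) (norm_nonneg _)
  · ext m
    exact (hz l hl m).trans (hTH (l, z l) ⟨hl, hzO l hl⟩ m).symm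

/-- A bounded family of functions which is dominated by a weighted contraction of itself, up to
terms which tend to zero, tends to zero pointwise. -/
theorem tendsto_zero_of_le_tsum {α ι : Type*} {l : Filter α} {D e : ι → α → ℝ} {a : ι → ι → ℝ}
    {q B : ℝ} (hq1 : q < 1) (ha0 : ∀ m n, 0 ≤ a m n) (hsum : ∀ m, Summable (a m))
    (hq : ∀ m, ∑' n, a m n ≤ q) (hB : 0 ≤ B) (hD0 : ∀ m x, 0 ≤ D m x)
    (hDB : ∀ᶠ x in l, ∀ m, D m x ≤ B) (he : ∀ m, Tendsto (e m) l (𝓝 0))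
    (hDe : ∀ m, ∀ᶠ x in l, D m x ≤ ∑' n, a m n * D n x + e m x) (m : ι) :
    Tendsto (D m) l (𝓝 0) := by
  have hq0 : 0 ≤ q := (tsum_nonneg (ha0 m)).trans (hq m)
  have main : ∀ j : ℕ, ∀ m, Tendsto (fun x => max (D m x - q ^ j * B) 0) l (𝓝 0) := by
    intro j
    induction j with
    | zero =>
      intro m
      refine tendsto_const_nhds.congr' ?_
      filter_upwards [hDB] with x hx
      rw [max_eq_right]
      simpa using hx m
    | succ j ih =>
      intro m
      have hts : Tendsto (fun x => ∑' n, a m n * max (D n x - q ^ j * B) 0) l (𝓝 0) := by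
        have := tendsto_tsum_of_dominated_convergence (𝓕 := l) ((hsum m).mul_right B)
          (f := fun x n => a m n * max (D n x - q ^ j * B) 0) (g := fun _ => 0)
          (fun n => by simpa using (ih n).const_mul (a m n)) ?_
        · simpa using this
        filter_upwards [hDB] with x hx n
        rw [Real.norm_of_nonneg (mul_nonneg (ha0 m n) (le_max_right _ _))]
        refine mul_le_mul_of_nonneg_left (max_le ?_ hB) (ha0 m n)
        have : 0 ≤ q ^ j * B := by positivity
        linarith [hx n]
      refine tendsto_of_tendsto_of_tendsto_of_le_of_le' tendsto_const_nhds
        (by simpa using hts.add ((he m).abs)) (Eventually.of_forall fun x => le_max_right _ _) ?_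
      filter_upwards [hDB, hDe m] with x hx hxe
      have s1 : Summable fun n => a m n * max (D n x - q ^ j * B) 0 := by
        refine .of_nonneg_of_le (fun n => mul_nonneg (ha0 m n) (le_max_right _ _)) (fun n => ?_)
          ((hsum m).mul_right B)
        refine mul_le_mul_of_nonneg_left (max_le ?_ hB) (ha0 m n)
        have : 0 ≤ q ^ j * B := by positivity
        linarith [hx n]
      have s2 := (hsum m).mul_right (q ^ j * B)
      have s3 : Summable fun n => a m n * D n x :=
        .of_nonneg_of_le (fun n => mul_nonneg (ha0 m n) (hD0 n x))
          (fun n => mul_le_mul_of_nonneg_left (hx n) (ha0 m n)) ((hsum m).mul_right B)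
      have h1 : ∑' n, a m n * D n x
          ≤ ∑' n, a m n * max (D n x - q ^ j * B) 0 + ∑' n, a m n * (q ^ j * B) := by
        rw [← s1.tsum_add s2]
        refine s3.tsum_le_tsum (fun n => ?_) (s1.add s2)
        rw [← mul_add]
        refine mul_le_mul_of_nonneg_left ?_ (ha0 m n)
        linarith [le_max_left (D n x - q ^ j * B) 0]
      have h2 : ∑' n, a m n * (q ^ j * B) ≤ q ^ (j + 1) * B := by
        rw [tsum_mul_right, pow_succ, mul_comm (q ^ j) q, mul_assoc]
        exact mul_le_mul_of_nonneg_right (hq m) (by positivity)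
      have h3 : 0 ≤ ∑' n, a m n * max (D n x - q ^ j * B) 0 :=
        tsum_nonneg fun n => mul_nonneg (ha0 m n) (le_max_right _ _)
      refine max_le ?_ (add_nonneg h3 (abs_nonneg _))
      linarith [le_abs_self (e m x)]
  refine tendsto_order.2 ⟨fun b hb => Eventually.of_forall fun x => hb.trans_le (hD0 m x),
    fun b hb => ?_⟩
  have hpow : Tendsto (fun j : ℕ => q ^ j * B) atTop (𝓝 0) := by
    simpa using (tendsto_pow_atTop_nhds_zero_of_lt_one hq0 hq1).mul_const B
  obtain ⟨j, hj⟩ := (hpow.eventually (gt_mem_nhds (half_pos hb))).exists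
  filter_upwards [(main j m).eventually (gt_mem_nhds (half_pos hb))] with x hx
  linarith [le_max_left (D m x - q ^ j * B) 0]

/-- Coordinatewise continuity in the parameter of the bounded solutions of
`z_m = ∑ G(m, n) F_{n-1}(λ, z_{n-1})`. -/
theorem continuousOn_green_fixedPoint {Λ : Type*} [TopologicalSpace Λ] [CompleteSpace X]
    {G : ℤ → ℤ → X →L[ℝ] X} {S : Set Λ} {c ε : ℤ → ℝ} (hc0 : ∀ n, 0 ≤ c n) (hε0 : ∀ n, 0 < ε n)
    {q : ℝ} (hq1 : q < 1) (hqsum : ∀ m, Summable fun n => c (n - 1) * ‖G m n‖)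
    (hq : ∀ m, ∑' n, c (n - 1) * ‖G m n‖ ≤ q) (hLsum : ∀ m, Summable fun n => ε (n - 1) * ‖G m n‖)
    {F : ℤ → Λ × X → X} (hF : ∀ n, ContinuousOn (F n) (S ×ˢ univ))
    (hlip : ∀ n, ∀ l ∈ S, ∀ ξ η, ‖F n (l, ξ) - F n (l, η)‖ ≤ c n * ‖ξ - η‖)
    (hF0 : ∀ n, ∀ l ∈ S, ‖F n (l, 0)‖ ≤ ε n) {B : ℝ} {z : Λ → ℤ → X}
    (hzB : ∀ l ∈ S, ∀ n, ‖z l n‖ ≤ B)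
    (hz : ∀ l ∈ S, ∀ m, z l m = ∑' n, G m n (F (n - 1) (l, z l (n - 1)))) (m : ℤ) :
    ContinuousOn (fun l => z l m) S := by
  intro l₀ hl₀
  have hB : 0 ≤ B := (norm_nonneg _).trans (hzB l₀ hl₀ 0)
  have hw : ∀ m, Summable fun n => (c (n - 1) + ε (n - 1)) * ‖G m n‖ := fun m => by
    simpa only [add_mul] using (hqsum m).add (hLsum m)
  have hFb : ∀ n, ∀ l ∈ S, ∀ ξ, ‖ξ‖ ≤ B → ‖F n (l, ξ)‖ ≤ (1 + B) * (c n + ε n) := by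
    intro n l hl ξ hξ
    refine (norm_le_of_lipschitz (F := fun ξ => F n (l, ξ)) (hc0 n) (hlip n l hl) (hF0 n l hl)
      hξ).trans ?_
    nlinarith [hc0 n, hε0 n, mul_nonneg (hε0 n).le hB]
  have hs : ∀ l ∈ S, ∀ ζ : ℤ → X, (∀ n, ‖ζ n‖ ≤ B) → ∀ m,
      Summable fun n => G m n (F (n - 1) (l, ζ (n - 1))) :=
    fun l hl ζ hζ m => summable_apply_shift (g := G m) (w := fun n => c n + ε n) (b := 1 + B)
      (u := fun n => F n (l, ζ n)) (hw m) fun n => hFb n l hl _ (hζ n)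
  refine tendsto_iff_norm_sub_tendsto_zero.2 ?_
  obtain ⟨e, he_eq⟩ : ∃ e : ℤ → Λ → ℝ, ∀ m, e m = fun l =>
      ‖∑' n, G m n (F (n - 1) (l, z l₀ (n - 1))) - ∑' n, G m n (F (n - 1) (l₀, z l₀ (n - 1)))‖ :=
    ⟨_, fun _ => rfl⟩
  have he : ∀ m, Tendsto (e m) (𝓝[S] l₀) (𝓝 0) := fun m => by
    rw [he_eq]
    refine tendsto_iff_norm_sub_tendsto_zero.1 ?_
    refine tendsto_tsum_of_dominated_convergence ((hw m).mul_left (1 + B)) (fun n => ?_) ?_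
    · refine ((G m n).continuous.tendsto _).comp ?_
      exact (hF (n - 1) (l₀, z l₀ (n - 1)) ⟨hl₀, mem_univ _⟩).tendsto.comp
        (tendsto_nhdsWithin_iff.2 ⟨(tendsto_id.mono_left nhdsWithin_le_nhds).prodMk_nhds
          tendsto_const_nhds, by
          filter_upwards [self_mem_nhdsWithin] with l hl using ⟨hl, mem_univ _⟩⟩)
    · filter_upwards [self_mem_nhdsWithin] with l hl n
      exact norm_apply_shift_le (g := G m) (w := fun n => c n + ε n) (b := 1 + B)
        (u := fun n => F n (l, z l₀ n))
        (fun n => hFb n l hl _ (hzB l₀ hl₀ n)) n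
  have key : ∀ m, Tendsto (fun l => ‖z l (m - 1) - z l₀ (m - 1)‖) (𝓝[S] l₀) (𝓝 0) := by
    refine tendsto_zero_of_le_tsum (D := fun m l => ‖z l (m - 1) - z l₀ (m - 1)‖)
      (e := fun m => e (m - 1)) (a := fun m n => c (n - 1) * ‖G (m - 1) n‖) (B := B + B) hq1
      (fun m n => mul_nonneg (hc0 _) (norm_nonneg _)) (fun m => hqsum _) (fun m => hq _)
      (by positivity) (fun m l => norm_nonneg _) ?_ (fun m => he _) (fun m => ?_)
    · filter_upwards [self_mem_nhdsWithin] with l hl n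
      exact (norm_sub_le _ _).trans (add_le_add (hzB l hl _) (hzB l₀ hl₀ _))
    · filter_upwards [self_mem_nhdsWithin] with l hl
      rw [hz l hl (m - 1), hz l₀ hl₀ (m - 1), he_eq]
      refine (norm_sub_le_norm_sub_add_norm_sub _
        (∑' n, G (m - 1) n (F (n - 1) (l, z l₀ (n - 1)))) _).trans (add_le_add ?_ le_rfl)
      rw [← (hs l hl _ (hzB l hl) _).tsum_sub (hs l hl _ (hzB l₀ hl₀) _)]
      refine tsum_of_norm_bounded (Summable.hasSum ?_) fun n => ?_
      · refine .of_nonneg_of_le (fun n => mul_nonneg (mul_nonneg (hc0 _) (norm_nonneg _))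
          (norm_nonneg _)) (fun n => ?_) ((hqsum (m - 1)).mul_right (B + B))
        exact mul_le_mul_of_nonneg_left
          ((norm_sub_le _ _).trans (add_le_add (hzB l hl _) (hzB l₀ hl₀ _)))
          (mul_nonneg (hc0 _) (norm_nonneg _))
      · rw [← map_sub]
        refine ((G (m - 1) n).le_opNorm_of_le (hlip (n - 1) l hl _ _)).trans (le_of_eq (by ring))
  simpa using key (m + 1)
end

end

/-- Theorem: `C^k` parameterized shadowing, discrete time. Under the
assumptions of the discrete shadowing theorem, if the regularity conditions (D1) and
(D2) hold, then for each `n ∈ ℤ` the map `λ ↦ x^λ_n` is `C^k` on `Σ`. -/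
theorem stmt14
    {X : Type*} [NormedAddCommGroup X] [NormedSpace ℝ X] [CompleteSpace X]
    {E : Type*} [NormedAddCommGroup E] [NormedSpace ℝ E]
    (A : ℤ → X ≃L[ℝ] X)
    (𝒜 : ℤ → ℤ → X →L[ℝ] X)
    (h𝒜id : ∀ n, 𝒜 n n = 1)
    (h𝒜 : ∀ m n, 𝒜 (m + 1) n = ((A m : X →L[ℝ] X)).comp (𝒜 m n))
    (P : ℤ → X →L[ℝ] X)
    (G : ℤ → ℤ → X →L[ℝ] X)
    (hG : ∀ m n, G m n = if n ≤ m then (𝒜 m n).comp (P n)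
      else -((𝒜 m n).comp (1 - P n)))
    (Sg : Set E) (hSg : IsOpen Sg) (hSgne : Sg.Nonempty)
    (f : E → ℤ → X → X)
    (c : ℤ → ℝ) (hc0 : ∀ n, 0 ≤ c n)
    (hlip : ∀ lam ∈ Sg, ∀ n (x₁ x₂ : X),
      ‖f lam n x₁ - f lam n x₂‖ ≤ c n * ‖x₁ - x₂‖)
    (q : ℝ) (hq1 : q < 1)
    (hqsum : ∀ m, Summable (fun n : ℤ => c (n - 1) * ‖G m n‖))
    (hq : ∀ m, (∑' n : ℤ, c (n - 1) * ‖G m n‖) ≤ q)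
    (eps : ℤ → ℝ) (heps0 : ∀ n, 0 < eps n)
    (L : ℝ)
    (hLsum : ∀ m, Summable (fun n : ℤ => eps (n - 1) * ‖G m n‖))
    (hL : ∀ m, (∑' n : ℤ, eps (n - 1) * ‖G m n‖) ≤ L)
    (hnb : ∀ x : ℤ → X, (∀ n, x (n + 1) = A n (x n)) →
      (∃ M, ∀ n, ‖x n‖ ≤ M) → ∀ n, x n = 0)
    -- the approximate solutions y^λ
    (y : E → ℤ → X)
    (hpse : ∀ lam ∈ Sg, ∀ n,
      ‖y lam (n + 1) - A n (y lam n) - f lam n (y lam n)‖ ≤ eps n)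
    -- the shadowing solutions x^λ
    (x : E → ℤ → X)
    (hxsol : ∀ lam ∈ Sg, ∀ n, x lam (n + 1) = A n (x lam n) + f lam n (x lam n))
    (hxshad : ∀ lam ∈ Sg, ∀ n, ‖x lam n - y lam n‖ ≤ L / (1 - q))
    (k : ℕ) (C : ℝ) (hC : 0 < C)
    -- (D1): (λ,x) ↦ f_λ(n,x) is C^{k+1} with mixed partials of order 2 ≤ i ≤ k+1
    -- bounded by Cε_n
    (hfC : ∀ n, ContDiffOn ℝ ((k : ℕ∞) + 1) (fun p : E × X => f p.1 n p.2) (Sg ×ˢ univ))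
    (hfbound : ∀ i : ℕ, 2 ≤ i → i ≤ k + 1 → ∀ n : ℤ, ∀ lam ∈ Sg, ∀ ξ : X,
      ‖iteratedFDerivWithin ℝ i (fun p : E × X => f p.1 n p.2) (Sg ×ˢ univ) (lam, ξ)‖
        ≤ C * eps n)
    -- (D2): λ ↦ y^λ_n is C^{k+1} with
    -- ‖∂^i_λ y^λ_{n+1} − A_n ∂^i_λ y^λ_n − d^i/dλ^i f_λ(n, y^λ_n)‖ ≤ Cε_n
    (hyC : ∀ n : ℤ, ContDiffOn ℝ ((k : ℕ∞) + 1) (fun lam => y lam n) Sg)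
    (hD2 : ∀ i : ℕ, 1 ≤ i → i ≤ k + 1 → ∀ n : ℤ, ∀ lam ∈ Sg,
      ‖iteratedFDerivWithin ℝ i (fun mu => y mu (n + 1)) Sg lam
        - ((A n : X →L[ℝ] X)).compContinuousMultilinearMap
            (iteratedFDerivWithin ℝ i (fun mu => y mu n) Sg lam)
        - iteratedFDerivWithin ℝ i (fun mu => f mu n (y mu n)) Sg lam‖ ≤ C * eps n)
    -- local uniform bounds on the λ-derivatives of y
    (hM : ∀ lam₀ ∈ Sg, ∃ M : ℝ, 1 < M ∧ ∃ S₀ ∈ nhds lam₀, S₀ ⊆ Sg ∧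
      ∀ lam ∈ S₀, ∀ i : ℕ, 1 ≤ i → i ≤ k + 1 → ∀ n : ℤ,
        ‖iteratedFDerivWithin ℝ i (fun mu => y mu n) Sg lam‖ ≤ M) :
    ∀ n : ℤ, ContDiffOn ℝ (k : ℕ∞) (fun lam => x lam n) Sg := by
  have hk1 : (((k : ℕ∞) : WithTop ℕ∞) + 1) = ((k + 1 : ℕ) : WithTop ℕ∞) := by push_cast; rfl
  rw [hk1] at hfC hyC
  have hB : 0 ≤ L / (1 - q) :=
    hSgne.elim fun l hl => (norm_nonneg _).trans (hxshad l hl 0)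
  have hyp : ∀ n, ContDiffOn ℝ (k + 1 : ℕ) (fun p : E × X => y p.1 n) (Sg ×ˢ univ) := fun n =>
    (hyC n).comp contDiff_fst.contDiffOn fun p hp => hp.1
  obtain ⟨F, hF⟩ : ∃ F : ℤ → E × X → X, ∀ n, F n = fun p =>
    f p.1 n (y p.1 n + p.2) + (A n : X →L[ℝ] X) (y p.1 n) - y p.1 (n + 1) := ⟨_, fun _ => rfl⟩
  have hFC : ∀ n, ContDiffOn ℝ (k + 1 : ℕ) (F n) (Sg ×ˢ univ) := fun n => by
    rw [hF]
    exact (((hfC n).comp (contDiff_fst.contDiffOn.prodMk ((hyp n).add contDiff_snd.contDiffOn))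
      fun p hp => ⟨hp.1, mem_univ _⟩).add
        ((A n : X →L[ℝ] X).contDiff.comp_contDiffOn (hyp n))).sub (hyp (n + 1))
  have hFlip : ∀ n, ∀ l ∈ Sg, ∀ ξ η, ‖F n (l, ξ) - F n (l, η)‖ ≤ c n * ‖ξ - η‖ := by
    intro n l hl ξ η
    simpa [hF] using hlip l hl n (y l n + ξ) (y l n + η)
  have hF0 : ∀ n, ∀ l ∈ Sg, ‖F n (l, 0)‖ ≤ eps n := by
    intro n l hl
    rw [← norm_neg]
    refine le_trans (le_of_eq (congrArg norm ?_)) (hpse l hl n)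
    simp only [hF, add_zero, ContinuousLinearEquiv.coe_coe]
    abel
  have hz : ∀ l ∈ Sg, ∀ m,
      x l m - y l m = ∑' n, G m n (F (n - 1) (l, x l (n - 1) - y l (n - 1))) := by
    intro l hl m
    refine eq_tsum_green (A := fun n => (A n : X →L[ℝ] X)) (w := fun n => c n + eps n) (Q := q + L)
      (u := fun n => F n (l, x l n - y l n)) (z := fun n => x l n - y l n)
      (b := 1 + L / (1 - q)) (B := L / (1 - q)) (fun m n hmn => ?_) (fun m => ?_) hnb (fun m => ?_)
      (fun m => ?_) (by linarith) (fun n => ?_) (fun n => ?_) (hxshad l hl) m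
    · rw [hG, hG, h𝒜]
      rcases lt_or_gt_of_ne hmn with h | h
      · rw [if_pos h.le, if_pos (Int.lt_add_one_iff.1 h), ContinuousLinearMap.comp_assoc]
      · rw [if_neg (by omega), if_neg (by omega), ContinuousLinearMap.comp_neg,
          ContinuousLinearMap.comp_assoc]
    · have h1 : (A m : X →L[ℝ] X).comp (𝒜 m (m + 1)) = 1 := by rw [← h𝒜, h𝒜id]
      rw [hG, hG, if_pos le_rfl, if_neg (by omega), ContinuousLinearMap.comp_neg,
        ← ContinuousLinearMap.comp_assoc, h1, h𝒜id]
      ext v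
      simp
    · simpa only [add_mul] using (hqsum m).add (hLsum m)
    · simp only [add_mul]
      rw [(hqsum m).tsum_add (hLsum m)]
      exact add_le_add (hq m) (hL m)
    · refine (norm_le_of_lipschitz (F := fun ξ => F n (l, ξ)) (hc0 n) (hFlip n l hl) (hF0 n l hl)
        (hxshad l hl n)).trans ?_
      have h1 := mul_nonneg (heps0 n).le hB
      have h2 := hc0 n
      linarith
    · simp only [hF, hxsol l hl n, map_sub, ContinuousLinearEquiv.coe_coe, add_sub_cancel]
      abel
  rcases Nat.eq_zero_or_pos k with rfl | hk
  · intro n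
    have h := continuousOn_green_fixedPoint (z := fun l n => x l n - y l n) hc0 heps0 hq1 hqsum hq
      hLsum (fun n => (hFC n).continuousOn) hFlip hF0 hxshad hz n
    refine contDiffOn_zero.2 ((h.add (hyC n).continuousOn).congr fun l _ => ?_)
    exact (sub_add_cancel _ _).symm
  intro n l₀ hl₀
  obtain ⟨M, hM1, S₀, hS₀, hS₀Sg, hyM⟩ := hM l₀ hl₀
  obtain ⟨r, hr, hball⟩ := Metric.mem_nhds_iff.1 hS₀
  have hS : IsOpen (Metric.ball l₀ r) := Metric.isOpen_ball
  have hSsub : Metric.ball l₀ r ⊆ Sg := hball.trans hS₀Sg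
  have hprod : Metric.ball l₀ r ×ˢ (univ : Set X) ⊆ Sg ×ˢ univ := prod_mono hSsub subset_rfl
  have hSgX : IsOpen (Sg ×ˢ (univ : Set X)) := hSg.prod isOpen_univ
  have hzB : ∀ l ∈ Sg, ∀ n, toBounded (fun n => x l n - y l n) n = x l n - y l n := fun l hl =>
    toBounded_apply (hxshad l hl)
  have heval : ∀ n : ℤ, ‖BoundedContinuousFunction.evalCLM (β := X) ℝ n‖ ≤ 1 := fun n =>
    ContinuousLinearMap.opNorm_le_bound _ zero_le_one fun u => by
      rw [one_mul]; exact u.norm_coe_le_norm n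
  set D := 1 + (2 * ((k + 1).factorial : ℝ) + (L / (1 - q) + 1)) * (2 + M) ^ (k + 1) with hD
  have hD0 : 0 ≤ D := by positivity
  have main := contDiffOn_green_fixedPoint (S := Metric.ball l₀ r) (c := c) (ε := eps) (F := F)
    (G := G) (R := L / (1 - q) + 1) (K := C * D + 1)
    (z := fun l => toBounded fun n => x l n - y l n)
    hS (convex_ball _ _) hc0 heps0 hq1 hqsum hq hLsum hL hk (fun n => (hFC n).mono hprod)
    (fun n l hl => hFlip n l (hSsub hl)) (fun n l hl => hF0 n l (hSsub hl))
    (fun n i hi1 hi l hl ζ hζ => ?_) (fun l hl => ?_) (fun l hl m => ?_)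
  · have h := (BoundedContinuousFunction.evalCLM (β := X) ℝ n).contDiff.comp_contDiffOn main
    refine ((h.add ((hyC n).mono hSsub |>.of_le (by exact_mod_cast k.le_succ))).congr
      fun l hl => ?_).contDiffAt (hS.mem_nhds (Metric.mem_ball_self hr)) |>.contDiffWithinAt
    simp [hzB l (hSsub hl)]
  · have h := norm_iteratedFDeriv_deviation_le hS (f := fun p : E × X => f p.1 n p.2)
      (y := fun l => y l n) (y' := fun l => y l (n + 1)) (A := A n) (a := C * eps n) (M := M) hk
      (mul_nonneg hC.le (heps0 n).le) (by linarith) (hc0 n) ((hfC n).mono hprod)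
      ((hyC n).mono hSsub) ((hyC (n + 1)).mono hSsub)
      (fun l hl ξ η => hlip l (hSsub hl) n ξ η)
      (fun j hj2 hj l hl ξ => ?_) (fun j hj1 hj l hl => ?_) (fun j hj1 hj l hl => ?_)
      (heval n) hl hζ hi1 hi
    · simp only [hF]
      refine h.trans ?_
      have h1 := mul_nonneg (mul_nonneg hC.le hD0) (hc0 n)
      have h2 := heps0 n
      linarith
    · rw [← iteratedFDerivWithin_of_isOpen j hSgX (x := (l, ξ)) ⟨hSsub hl, mem_univ _⟩]
      exact hfbound j hj2 hj n l (hSsub hl) ξ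
    · rw [← iteratedFDerivWithin_of_isOpen j hSg (hSsub hl)]
      exact hyM l (hball hl) j hj1 hj n
    · have h := hD2 j hj1 hj n l (hSsub hl)
      simp only [iteratedFDerivWithin_of_isOpen j hSg (hSsub hl)] at h
      exact h
  · refine lt_of_le_of_lt ((BoundedContinuousFunction.norm_le hB).2 fun n => ?_) (lt_add_one _)
    rw [hzB l (hSsub hl)]
    exact hxshad l (hSsub hl) n
  · simp only [hzB l (hSsub hl)]
    exact hz l (hSsub hl) m
end

section
/- Assume q̂ < 1 and L̂ < ∞; for each λ ∈ Σ let (y^λ_n)_{n∈ℤ} satisfy |y^λ_{n+1} − A_n y^λ_n − f_λ(n, y^λ_n)| ≤ ε_n for all n ∈ ℤ, let k ∈ ℕ, and suppose there is C > 0 such that conditions (D1) and (D2) hold. Then the map (λ, z) ↦ 𝒯̂_λ z is C^k with respect to z on an open subset of Σ × 𝒴̂ containing 𝒮̂ := {(λ, z^{λ̄}) : λ, λ̄ ∈ Σ}, and for 1 ≤ i ≤ k its i-th partial derivative in z is given by ((∂^i_z 𝒯̂_λ z)(η¹,…,ηⁱ))_n = Σ_{k∈ℤ} Ĝ(n,k)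 (∂^i_x f_λ(k−1, y^λ_{k−1} + z_{k−1}))(η¹_{k−1},…,ηⁱ_{k−1}) for η¹,…,ηⁱ ∈ 𝒴̂ and n ∈ ℤ. -/
open Set
open scoped BoundedContinuousFunction

open Classical in
/-- A bounded family as a bounded function on a discrete space (`0` if the family is unbounded). -/
noncomputable def boundedFamily {ι V : Type*} [TopologicalSpace ι] [DiscreteTopology ι]
    [NormedAddCommGroup V] (M : ι → V) : ι →ᵇ V :=
  if h : ∃ B, ∀ j, ‖M j‖ ≤ B then
    BoundedContinuousFunction.ofNormedAddCommGroupDiscrete M h.choose h.choose_spec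
  else 0

theorem boundedFamily_apply {ι V : Type*} [TopologicalSpace ι] [DiscreteTopology ι]
    [NormedAddCommGroup V] {M : ι → V} {B : ℝ} (h : ∀ j, ‖M j‖ ≤ B) (j : ι) :
    boundedFamily M j = M j := by
  have h' : ∃ B, ∀ j, ‖M j‖ ≤ B := ⟨B, h⟩
  simp [boundedFamily, h']

section Nemytskii

theorem update_apply_eq_update {ι κ X : Type*} [TopologicalSpace ι]
    [NormedAddCommGroup X] [DecidableEq κ] (η : κ → ι →ᵇ X) (l : κ) (a : ι →ᵇ X) (j : ι) :
    (fun l' => Function.update η l a l' j) = Function.update (fun l' => η l' j) l (a j) := by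
  ext l'
  by_cases hl : l' = l
  · subst hl; simp
  · simp [hl]

variable {ι X V : Type*} [TopologicalSpace ι]
  [NormedAddCommGroup X] [NormedSpace ℝ X] [NormedAddCommGroup V] [NormedSpace ℝ V]

theorem norm_pointwiseMultilinear_apply_le {i : ℕ} (M : ι →ᵇ (X [×i]→L[ℝ] V))
    (η : Fin i → ι →ᵇ X) (j : ι) :
    ‖M j (fun l => η l j)‖ ≤ ‖M‖ * ∏ l, ‖η l‖ := by
  refine (ContinuousMultilinearMap.le_opNorm _ _).trans ?_
  gcongr
  · exact M.norm_coe_le_norm j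
  · exact (η _).norm_coe_le_norm j

variable [DiscreteTopology ι]

/-- The multilinear map on bounded functions acting pointwise through a bounded family of
multilinear maps. -/
noncomputable def pointwiseMultilinear {i : ℕ} (M : ι →ᵇ (X [×i]→L[ℝ] V)) :
    (ι →ᵇ X) [×i]→L[ℝ] (ι →ᵇ V) :=
  MultilinearMap.mkContinuous
    { toFun := fun η => BoundedContinuousFunction.ofNormedAddCommGroupDiscrete
        (fun j => M j (fun l => η l j)) _ (norm_pointwiseMultilinear_apply_le M η)
      map_update_add' := by
        intro _ η l a b
        ext j
        simp [update_apply_eq_update]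
      map_update_smul' := by
        intro _ η l t a
        ext j
        simp [update_apply_eq_update] }
    ‖M‖ (fun η => by
      rw [BoundedContinuousFunction.norm_le (by positivity)]
      exact norm_pointwiseMultilinear_apply_le M η)

@[simp]
theorem pointwiseMultilinear_apply {i : ℕ} (M : ι →ᵇ (X [×i]→L[ℝ] V))
    (η : Fin i → ι →ᵇ X) (j : ι) :
    pointwiseMultilinear M η j = M j (fun l => η l j) := rfl

theorem norm_pointwiseMultilinear_sub_le {i : ℕ} {M M' : ι →ᵇ (X [×i]→L[ℝ] V)} {B : ℝ} (hB : 0 ≤ B)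
    (h : ∀ j, ‖M j - M' j‖ ≤ B) : ‖pointwiseMultilinear M - pointwiseMultilinear M'‖ ≤ B := by
  refine ContinuousMultilinearMap.opNorm_le_bound hB fun η => ?_
  rw [BoundedContinuousFunction.norm_le (by positivity)]
  intro j
  change ‖(M j - M' j) (fun l => η l j)‖ ≤ _
  refine (ContinuousMultilinearMap.le_opNorm _ _).trans ?_
  gcongr
  · exact h j
  · exact (η _).norm_coe_le_norm j

theorem norm_image_sub_sub_le_of_lipschitz {g : X → V} {g' : X → X →L[ℝ] V} {K : ℝ}
    (hK : 0 ≤ K) (hg : ∀ x, HasFDerivAt g (g' x) x)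
    (hg' : ∀ x x', ‖g' x - g' x'‖ ≤ K * ‖x - x'‖) (x x' : X) :
    ‖g x' - g x - g' x (x' - x)‖ ≤ K * ‖x' - x‖ * ‖x' - x‖ := by
  refine Convex.norm_image_sub_le_of_norm_hasFDerivWithin_le' (𝕜 := ℝ)
    (s := Metric.closedBall x ‖x' - x‖) (f' := g')
    (fun v _ => (hg v).hasFDerivWithinAt) (fun v hv => (hg' v x).trans ?_)
    (convex_closedBall _ _) (Metric.mem_closedBall_self (norm_nonneg _)) ?_
  · gcongr
    simpa [dist_eq_norm] using hv
  · simp [dist_eq_norm]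

theorem hasFDerivAt_of_norm_sub_sub_le {g : X → V} {g' : X →L[ℝ] V} {x : X} {K : ℝ}
    (hK : 0 ≤ K) (h : ∀ x', ‖g x' - g x - g' (x' - x)‖ ≤ K * ‖x' - x‖ * ‖x' - x‖) :
    HasFDerivAt g g' x := by
  refine HasFDerivAt.of_isLittleO (Asymptotics.isLittleO_iff.2 fun c hc => ?_)
  filter_upwards [Metric.ball_mem_nhds x (show 0 < c / (K + 1) by positivity)] with x' hx'
  refine (h x').trans ?_
  gcongr
  have h1 : ‖x' - x‖ < c / (K + 1) := by simpa [dist_eq_norm] using hx'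
  rw [lt_div_iff₀ (by positivity)] at h1
  nlinarith [norm_nonneg (x' - x)]

theorem hasFDerivAt_iteratedFDeriv {g : X → V} {n m : ℕ} (hg : ContDiff ℝ n g) (hm : m < n)
    (x : X) : HasFDerivAt (iteratedFDeriv ℝ m g) (iteratedFDeriv ℝ (m + 1) g x).curryLeft x := by
  have h : ContDiff ℝ ((n : ℕ∞) : WithTop ℕ∞) g := by exact_mod_cast hg
  exact (contDiff_iff_ftaylorSeries.1 h).fderiv m (by exact_mod_cast hm) x

theorem norm_iteratedFDeriv_sub_le_s15 {g : X → V} {n m : ℕ} {K : ℝ} (hg : ContDiff ℝ n g)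
    (hm : m < n) (hK : ∀ x, ‖iteratedFDeriv ℝ (m + 1) g x‖ ≤ K) (x x' : X) :
    ‖iteratedFDeriv ℝ m g x - iteratedFDeriv ℝ m g x'‖ ≤ K * ‖x - x'‖ :=
  Convex.norm_image_sub_le_of_norm_fderiv_le (𝕜 := ℝ) (s := univ)
    (fun v _ => (hasFDerivAt_iteratedFDeriv hg hm v).differentiableAt)
    (fun v _ => by rw [norm_fderiv_iteratedFDeriv]; exact hK v) convex_univ trivial trivial

theorem hasFTaylorSeriesUpTo_nemytskii {k : ℕ} {h : ι → X → V}
    (hC : ∀ j, ContDiff ℝ (k + 1 : ℕ) (h j)) {K : ℝ} (hK0 : 0 ≤ K)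
    (hK : ∀ i, 1 ≤ i → i ≤ k + 1 → ∀ j x, ‖iteratedFDeriv ℝ i (h j) x‖ ≤ K)
    {N : (ι →ᵇ X) → (ι →ᵇ V)} (hN : ∀ w j, N w j = h j (w j)) :
    HasFTaylorSeriesUpTo (k : ℕ∞) N
      (fun w i =>
        pointwiseMultilinear (boundedFamily fun j => iteratedFDeriv ℝ i (h j) (w j))) := by
  have hbd : ∀ i, i ≤ k + 1 → ∀ (w : ι →ᵇ X) j,
      boundedFamily (fun j => iteratedFDeriv ℝ i (h j) (w j)) j
        = iteratedFDeriv ℝ i (h j) (w j) := by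
    intro i hi w j
    rcases Nat.eq_zero_or_pos i with rfl | hi0
    · refine boundedFamily_apply (B := ‖N w‖) (fun j => ?_) j
      rw [norm_iteratedFDeriv_zero, ← hN]
      exact (N w).norm_coe_le_norm j
    · exact boundedFamily_apply (fun j => hK i hi0 hi j _) j
  have hlip : ∀ i, i ≤ k → ∀ j x x',
      ‖iteratedFDeriv ℝ i (h j) x - iteratedFDeriv ℝ i (h j) x'‖ ≤ K * ‖x - x'‖ :=
    fun i hi j => norm_iteratedFDeriv_sub_le_s15 (hC j) (by omega)
      (fun x => hK _ (by omega) (by omega) j x)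
  refine ⟨fun w => ?_, fun m hm w => ?_, fun m hm => ?_⟩
  · ext j
    change pointwiseMultilinear _ _ j = _
    rw [pointwiseMultilinear_apply, hbd 0 (by omega), iteratedFDeriv_zero_apply, hN]
  · have hm' : m < k := by exact_mod_cast hm
    refine hasFDerivAt_of_norm_sub_sub_le hK0 fun w' => ?_
    refine ContinuousMultilinearMap.opNorm_le_bound (by positivity) fun η => ?_
    rw [BoundedContinuousFunction.norm_le (by positivity)]
    intro j
    have hcons : (fun l => (Fin.cons (w' - w) η : Fin (m + 1) → ι →ᵇ X) l j)
        = Fin.cons (w' j - w j) (fun l => η l j) := by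
      ext l
      refine Fin.cases ?_ (fun l => ?_) l <;> simp
    have heq : (pointwiseMultilinear (boundedFamily fun j => iteratedFDeriv ℝ m (h j) (w' j))
        - pointwiseMultilinear (boundedFamily fun j => iteratedFDeriv ℝ m (h j) (w j))
        - (pointwiseMultilinear (boundedFamily fun j => iteratedFDeriv ℝ (m + 1) (h j)
            (w j))).curryLeft (w' - w)) η j
        = (iteratedFDeriv ℝ m (h j) (w' j) - iteratedFDeriv ℝ m (h j) (w j)
          - (iteratedFDeriv ℝ (m + 1) (h j) (w j)).curryLeft (w' j - w j)) (fun l => η l j) := by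
      change (boundedFamily fun j => iteratedFDeriv ℝ m (h j) (w' j)) j (fun l => η l j)
        - (boundedFamily fun j => iteratedFDeriv ℝ m (h j) (w j)) j (fun l => η l j)
        - (boundedFamily fun j => iteratedFDeriv ℝ (m + 1) (h j) (w j)) j
            (fun l => (Fin.cons (w' - w) η : Fin (m + 1) → ι →ᵇ X) l j) = _
      rw [hbd m (by omega), hbd m (by omega), hbd (m + 1) (by omega), hcons]
      rfl
    refine (congrArg norm heq).trans_le ?_
    refine (ContinuousMultilinearMap.le_opNorm _ _).trans ?_
    have hrem := norm_image_sub_sub_le_of_lipschitz hK0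
      (fun x => hasFDerivAt_iteratedFDeriv (hC j) (show m < k + 1 by omega) x)
      (fun x x' => by
        have hsub : (iteratedFDeriv ℝ (m + 1) (h j) x).curryLeft
            - (iteratedFDeriv ℝ (m + 1) (h j) x').curryLeft
            = (iteratedFDeriv ℝ (m + 1) (h j) x - iteratedFDeriv ℝ (m + 1) (h j) x').curryLeft :=
          rfl
        rw [hsub, ContinuousMultilinearMap.curryLeft_norm]
        exact hlip (m + 1) hm' j x x') (w j) (w' j)
    have hw : ‖w' j - w j‖ ≤ ‖w' - w‖ := (w' - w).norm_coe_le_norm j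
    refine mul_le_mul (hrem.trans (by gcongr)) ?_ (by positivity) (by positivity)
    gcongr
    exact (η _).norm_coe_le_norm j
  · have hm' : m ≤ k := by exact_mod_cast hm
    refine (LipschitzWith.of_dist_le_mul (K := ⟨K, hK0⟩) fun w w' => ?_).continuous
    rw [dist_eq_norm, dist_eq_norm]
    refine norm_pointwiseMultilinear_sub_le (by positivity) fun j => ?_
    rw [hbd m (by omega), hbd m (by omega)]
    refine (hlip m hm' j _ _).trans ?_
    change _ ≤ K * _
    gcongr
    exact (w - w').norm_coe_le_norm j

end Nemytskii

section Partial

variable {E X V : Type*} [NormedAddCommGroup E] [NormedSpace ℝ E]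
  [NormedAddCommGroup X] [NormedSpace ℝ X] [NormedAddCommGroup V] [NormedSpace ℝ V]

theorem contDiff_partial {n : WithTop ℕ∞} {S : Set E} {F : E × X → V}
    (hF : ContDiffOn ℝ n F (S ×ˢ univ)) {a : E} (ha : a ∈ S) :
    ContDiff ℝ n (fun x => F (a, x)) :=
  contDiffOn_univ.1 (hF.comp (contDiff_const.prodMk contDiff_id).contDiffOn
    (fun _ _ => ⟨ha, trivial⟩))

theorem iteratedFDeriv_partial {n : WithTop ℕ∞} {S : Set E} (hS : IsOpen S) {F : E × X → V}
    (hF : ContDiffOn ℝ n F (S ×ˢ univ)) {a : E} (ha : a ∈ S) {i : ℕ} (hi : i ≤ n) (x : X) :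
    iteratedFDeriv ℝ i (fun x => F (a, x)) x
      = (iteratedFDerivWithin ℝ i F (S ×ˢ univ) (a, x)).compContinuousLinearMap
          (fun _ => ContinuousLinearMap.inr ℝ E X) := by
  have hU : IsOpen (S ×ˢ (univ : Set X)) := hS.prod isOpen_univ
  set U' : Set (E × X) := (fun p => (a, (0 : X)) + p) ⁻¹' (S ×ˢ univ) with hU'_def
  have hU' : IsOpen U' := hU.preimage (by fun_prop)
  have hpre : (ContinuousLinearMap.inr ℝ E X) ⁻¹' U' = univ := by
    ext v; simp [hU'_def, ha]
  have hmem : (ContinuousLinearMap.inr ℝ E X) x ∈ U' := by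
    simp [hU'_def, ha]
  have hF' : ContDiffOn ℝ n (fun p => F ((a, (0 : X)) + p)) U' :=
    hF.comp (contDiff_const.add contDiff_id).contDiffOn (fun _ hp => hp)
  have key := (ContinuousLinearMap.inr ℝ E X).iteratedFDerivWithin_comp_right hF'
    hU'.uniqueDiffOn (by rw [hpre]; exact uniqueDiffOn_univ) hmem hi
  rw [hpre, iteratedFDerivWithin_univ, iteratedFDerivWithin_of_isOpen i hU' hmem,
    iteratedFDeriv_comp_add_left] at key
  have hpt : (a, (0 : X)) + ContinuousLinearMap.inr ℝ E X x = (a, x) := by simp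
  rw [hpt] at key
  rw [iteratedFDerivWithin_of_isOpen i hU ⟨ha, trivial⟩, ← key]
  congr 1
  ext v
  simp

theorem norm_compContinuousLinearMap_inr_le {i : ℕ} (M : (E × X) [×i]→L[ℝ] V) :
    ‖M.compContinuousLinearMap (fun _ => ContinuousLinearMap.inr ℝ E X)‖ ≤ ‖M‖ := by
  refine (M.norm_compContinuousLinearMap_le _).trans (mul_le_of_le_one_right (norm_nonneg _) ?_)
  exact Finset.prod_le_one (fun _ _ => norm_nonneg _)
    (fun _ _ => ContinuousLinearMap.norm_inr_le_one ℝ E X)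

theorem norm_iteratedFDerivWithin_sub_le {n : WithTop ℕ∞} {U T : Set X} (hU : IsOpen U)
    (hTU : T ⊆ U) (hT : Convex ℝ T) {F : X → V} (hF : ContDiffOn ℝ n F U) {i : ℕ} (hi : i < n)
    {B : ℝ} (hB : ∀ x ∈ T, ‖iteratedFDerivWithin ℝ (i + 1) F U x‖ ≤ B) {x x' : X}
    (hx : x ∈ T) (hx' : x' ∈ T) :
    ‖iteratedFDerivWithin ℝ i F U x - iteratedFDerivWithin ℝ i F U x'‖ ≤ B * ‖x - x'‖ :=
  Convex.norm_image_sub_le_of_norm_hasFDerivWithin_le (𝕜 := ℝ)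
    (fun v hv => ((hF.differentiableOn_iteratedFDerivWithin hi hU.uniqueDiffOn v
      (hTU hv)).hasFDerivWithinAt).mono hTU)
    (fun v hv => by rw [norm_fderivWithin_iteratedFDerivWithin]; exact hB v hv) hT hx' hx

theorem iteratedFDeriv_smul_const_add_comp_add {g : X → V} {i : ℕ} (hg : ContDiff ℝ i g)
    (hi : 1 ≤ i) (t : ℝ) (r : V) (y x : X) :
    iteratedFDeriv ℝ i (fun v => t • (r + g (y + v))) x = t • iteratedFDeriv ℝ i g (y + x) := by
  have hg' : ContDiff ℝ i (fun v => g (y + v)) := hg.comp (contDiff_const.add contDiff_id)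
  have h1 := iteratedFDeriv_const_smul_apply (a := t) (x := x)
    ((contDiff_const (c := r)).add hg').contDiffAt
  have h2 := congrFun (iteratedFDeriv_add (contDiff_const (c := r)) hg') x
  rw [iteratedFDeriv_const_of_ne (by omega), zero_add, iteratedFDeriv_comp_add_left] at h2
  rw [← h2]
  exact h1

end Partial

theorem exists_summation_operator {X : Type*} [NormedAddCommGroup X] [NormedSpace ℝ X]
    [CompleteSpace X] {G : ℤ → ℤ → X →L[ℝ] X} (σ : ℤ → ℤ) {R : ℝ}
    (hs : ∀ n, Summable fun j => ‖G n j‖) (hR : ∀ n, ∑' j, ‖G n j‖ ≤ R) :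
    ∃ S : (ℤ →ᵇ X) →L[ℝ] (ℤ →ᵇ X), ∀ v n, S v n = ∑' j, G n j (v (σ j)) := by
  have hle : ∀ (v : ℤ →ᵇ X) n j, ‖G n j (v (σ j))‖ ≤ ‖G n j‖ * ‖v‖ := fun v n j =>
    ((G n j).le_opNorm _).trans (by gcongr; exact v.norm_coe_le_norm _)
  have hsum : ∀ (v : ℤ →ᵇ X) n, Summable fun j => G n j (v (σ j)) := fun v n =>
    Summable.of_norm_bounded ((hs n).mul_right _) (hle v n)
  have hnorm : ∀ (v : ℤ →ᵇ X) n, ‖∑' j, G n j (v (σ j))‖ ≤ R * ‖v‖ := fun v n =>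
    (tsum_of_norm_bounded ((hs n).hasSum.mul_right _) (hle v n)).trans (by gcongr; exact hR n)
  have hR0 : 0 ≤ R := (tsum_nonneg fun j => norm_nonneg (G 0 j)).trans (hR 0)
  let S : (ℤ →ᵇ X) →ₗ[ℝ] (ℤ →ᵇ X) :=
    { toFun := fun v => BoundedContinuousFunction.ofNormedAddCommGroupDiscrete _ _ (hnorm v)
      map_add' := fun v w => by
        ext n
        simpa using (hsum v n).tsum_add (hsum w n)
      map_smul' := fun t v => by
        ext n
        simpa using (hsum v n).tsum_const_smul t }
  exact ⟨S.mkContinuous R fun v => (BoundedContinuousFunction.norm_le (by positivity)).2 (hnorm v),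
    fun v n => rfl⟩

/-- Lemma: `C^k` regularity of `𝒯̂_λ z` in `z`. Under conditions
(D1) and (D2), the map `z ↦ 𝒯̂_λ z` is `C^k` on an open set `𝒲 ⊆ Σ × 𝒴̂` containing
`𝒮̂ = {(λ, z^{λ̄})}`, and for `1 ≤ i ≤ k` its `i`-th partial derivative in `z` is
`((∂^i_z 𝒯̂_λ z)(η¹,…,ηⁱ))_n = Σ_k Ĝ(n,k)(∂^i_x f_λ(k−1, y^λ_{k−1}+z_{k−1}))(η¹_{k−1},…,ηⁱ_{k−1})`,
the `i`-th derivative map being continuous on `𝒲`. -/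
theorem stmt15
    {X : Type*} [NormedAddCommGroup X] [NormedSpace ℝ X] [CompleteSpace X]
    {E : Type*} [NormedAddCommGroup E] [NormedSpace ℝ E]
    (A : ℤ → X ≃L[ℝ] X)
    (𝒜 : ℤ → ℤ → X →L[ℝ] X)
    (h𝒜id : ∀ n, 𝒜 n n = 1)
    (h𝒜 : ∀ m n, 𝒜 (m + 1) n = ((A m : X →L[ℝ] X)).comp (𝒜 m n))
    (P : ℤ → X →L[ℝ] X)
    (G : ℤ → ℤ → X →L[ℝ] X)
    (hG : ∀ m n, G m n = if n ≤ m then (𝒜 m n).comp (P n)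
      else -((𝒜 m n).comp (1 - P n)))
    (Sg : Set E) (hSg : IsOpen Sg) (hSgne : Sg.Nonempty)
    (f : E → ℤ → X → X)
    (c : ℤ → ℝ) (hc0 : ∀ n, 0 ≤ c n)
    (hlip : ∀ lam ∈ Sg, ∀ n (x₁ x₂ : X),
      ‖f lam n x₁ - f lam n x₂‖ ≤ c n * ‖x₁ - x₂‖)
    (q : ℝ) (hq1 : q < 1)
    (hqsum : ∀ m, Summable (fun n : ℤ => c (n - 1) * ‖G m n‖))
    (hq : ∀ m, (∑' n : ℤ, c (n - 1) * ‖G m n‖) ≤ q)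
    (eps : ℤ → ℝ) (heps0 : ∀ n, 0 < eps n)
    (L : ℝ)
    (hLsum : ∀ m, Summable (fun n : ℤ => eps (n - 1) * ‖G m n‖))
    (hL : ∀ m, (∑' n : ℤ, eps (n - 1) * ‖G m n‖) ≤ L)
    (y : E → ℤ → X)
    (hpse : ∀ lam ∈ Sg, ∀ n,
      ‖y lam (n + 1) - A n (y lam n) - f lam n (y lam n)‖ ≤ eps n)
    (k : ℕ) (C : ℝ) (hC : 0 < C)
    -- (D1)
    (hfC : ∀ n, ContDiffOn ℝ ((k : ℕ∞) + 1) (fun p : E × X => f p.1 n p.2) (Sg ×ˢ univ))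
    (hfbound : ∀ i : ℕ, 2 ≤ i → i ≤ k + 1 → ∀ n : ℤ, ∀ lam ∈ Sg, ∀ ξ : X,
      ‖iteratedFDerivWithin ℝ i (fun p : E × X => f p.1 n p.2) (Sg ×ˢ univ) (lam, ξ)‖
        ≤ C * eps n)
    -- (D2)
    (hyC : ∀ n : ℤ, ContDiffOn ℝ ((k : ℕ∞) + 1) (fun lam => y lam n) Sg)
    (hD2 : ∀ i : ℕ, 1 ≤ i → i ≤ k + 1 → ∀ n : ℤ, ∀ lam ∈ Sg,
      ‖iteratedFDerivWithin ℝ i (fun mu => y mu (n + 1)) Sg lam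
        - ((A n : X →L[ℝ] X)).compContinuousMultilinearMap
            (iteratedFDerivWithin ℝ i (fun mu => y mu n) Sg lam)
        - iteratedFDerivWithin ℝ i (fun mu => f mu n (y mu n)) Sg lam‖ ≤ C * eps n)
    (hM : ∀ lam₀ ∈ Sg, ∃ M : ℝ, 1 < M ∧ ∃ S₀ ∈ nhds lam₀, S₀ ⊆ Sg ∧
      ∀ lam ∈ S₀, ∀ i : ℕ, 1 ≤ i → i ≤ k + 1 → ∀ n : ℤ,
        ‖iteratedFDerivWithin ℝ i (fun mu => y mu n) Sg lam‖ ≤ M)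
    -- the operator 𝒯̂_λ and its fixed points z^λ
    (Top : E → BoundedContinuousFunction ℤ X → BoundedContinuousFunction ℤ X)
    (hTop : ∀ lam ∈ Sg, ∀ (z : BoundedContinuousFunction ℤ X) (n : ℤ),
      Top lam z n = ∑' j : ℤ, G n j
        (A (j - 1) (y lam (j - 1)) + f lam (j - 1) (z (j - 1) + y lam (j - 1))
          - y lam j))
    (z : E → BoundedContinuousFunction ℤ X)
    (hzfix : ∀ lam ∈ Sg, Top lam (z lam) = z lam)
    (hznorm : ∀ lam ∈ Sg, ‖z lam‖ ≤ L / (1 - q)) :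
    ∃ W : Set (E × BoundedContinuousFunction ℤ X), IsOpen W ∧
      {p : E × BoundedContinuousFunction ℤ X |
        p.1 ∈ Sg ∧ ∃ lam' ∈ Sg, p.2 = z lam'} ⊆ W ∧
      W ⊆ Sg ×ˢ univ ∧
      -- z ↦ 𝒯̂_λ z is k-times differentiable in z at every point of W
      (∀ p ∈ W, ContDiffAt ℝ (k : ℕ∞) (fun w => Top p.1 w) p.2) ∧
      ∀ i : ℕ, 1 ≤ i → i ≤ k →
        -- the i-th partial z-derivative is continuous on W
        ContinuousOn
          (fun p : E × BoundedContinuousFunction ℤ X =>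
            iteratedFDeriv ℝ i (fun w => Top p.1 w) p.2) W ∧
        -- and it is given by the series formula
        ∀ p ∈ W, ∀ η : Fin i → BoundedContinuousFunction ℤ X, ∀ n : ℤ,
          (iteratedFDeriv ℝ i (fun w => Top p.1 w) p.2 η) n =
            ∑' j : ℤ, G n j
              ((iteratedFDeriv ℝ i (fun ξ : X => f p.1 (j - 1) ξ)
                  (y p.1 (j - 1) + p.2 (j - 1)))
                (fun l => η l (j - 1))) := by
  have hU : IsOpen (Sg ×ˢ (univ : Set X)) := hSg.prod isOpen_univ
  have ha0 : ∀ m, 0 < c m + eps m := fun m => add_pos_of_nonneg_of_pos (hc0 m) (heps0 m)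
  have hweight : ∀ m t B : ℝ, 0 < m → t ≤ m * B → m⁻¹ * t ≤ B := fun m t B hm ht => by
    rwa [inv_mul_le_iff₀ hm]
  have hfS : ∀ lam ∈ Sg, ∀ m, ContDiff ℝ (k + 1 : ℕ) (f lam m) := fun lam hlam m => by
    exact_mod_cast contDiff_partial (hfC m) hlam
  have hpart : ∀ lam ∈ Sg, ∀ i : ℕ, i ≤ k + 1 → ∀ m x, iteratedFDeriv ℝ i (f lam m) x
      = (iteratedFDerivWithin ℝ i (fun p : E × X => f p.1 m p.2) (Sg ×ˢ univ)
          (lam, x)).compContinuousLinearMap (fun _ => ContinuousLinearMap.inr ℝ E X) :=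
    fun lam hlam i hi m x => iteratedFDeriv_partial hSg (hfC m) hlam (by exact_mod_cast hi) x
  -- the summation operator, with the weights `c + eps` built in
  obtain ⟨S, hS⟩ := exists_summation_operator
    (G := fun n j => (c (j - 1) + eps (j - 1)) • G n j) (fun j => j - 1) (R := q + L)
    (fun n => by
      simp only [norm_smul, Real.norm_of_nonneg (ha0 _).le, add_mul]
      exact (hqsum n).add (hLsum n))
    (fun n => by
      simp only [norm_smul, Real.norm_of_nonneg (ha0 _).le, add_mul]
      rw [(hqsum n).tsum_add (hLsum n)]
      exact add_le_add (hq n) (hL n))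
  -- the normalised nonlinearities
  let h : E → ℤ → X → X := fun lam m x =>
    (c m + eps m)⁻¹ • ((A m (y lam m) - y lam (m + 1)) + f lam m (y lam m + x))
  let N : E → (ℤ →ᵇ X) → (ℤ →ᵇ X) := fun lam w => boundedFamily fun m => h lam m (w m)
  have hN : ∀ lam ∈ Sg, ∀ w m, N lam w m = h lam m (w m) := by
    intro lam hlam w m
    refine boundedFamily_apply (B := 1 + ‖w‖) (fun m => ?_) m
    rw [norm_smul, Real.norm_of_nonneg (inv_nonneg.2 (ha0 m).le)]
    refine hweight _ _ _ (ha0 m) ?_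
    have hdec : (A m (y lam m) - y lam (m + 1)) + f lam m (y lam m + w m)
        = (f lam m (y lam m + w m) - f lam m (y lam m))
          - (y lam (m + 1) - A m (y lam m) - f lam m (y lam m)) := by abel
    have h1 := hlip lam hlam m (y lam m + w m) (y lam m)
    rw [add_sub_cancel_left] at h1
    have h2 := w.norm_coe_le_norm m
    rw [hdec]
    refine (norm_sub_le _ _).trans ((add_le_add h1 (hpse lam hlam m)).trans ?_)
    nlinarith [hc0 m, heps0 m, norm_nonneg w, mul_le_mul_of_nonneg_left h2 (hc0 m),
      mul_nonneg (heps0 m).le (norm_nonneg w)]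
  have hTopS : ∀ lam ∈ Sg, (fun w => Top lam w) = S ∘ N lam := by
    intro lam hlam
    ext w n
    rw [hTop lam hlam, Function.comp_apply, hS]
    refine tsum_congr fun j => ?_
    rw [hN lam hlam]
    simp only [h, sub_add_cancel, smul_apply, map_smul]
    rw [smul_smul, inv_mul_cancel₀ (ha0 _).ne', one_smul, add_comm (w (j - 1))]
    congr 1
    abel
  have hhd : ∀ lam ∈ Sg, ∀ i, 1 ≤ i → i ≤ k + 1 → ∀ m x, iteratedFDeriv ℝ i (h lam m) x
      = (c m + eps m)⁻¹ • iteratedFDeriv ℝ i (f lam m) (y lam m + x) :=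
    fun lam hlam i hi hik m x => iteratedFDeriv_smul_const_add_comp_add
      ((hfS lam hlam m).of_le (by exact_mod_cast hik)) hi _ _ _ _
  have hhC : ∀ lam ∈ Sg, ∀ m, ContDiff ℝ (k + 1 : ℕ) (h lam m) := fun lam hlam m =>
    contDiff_const.smul (contDiff_const.add
      ((hfS lam hlam m).comp (contDiff_const.add contDiff_id)))
  have hhb : ∀ lam ∈ Sg, ∀ i, 1 ≤ i → i ≤ k + 1 → ∀ m x,
      ‖iteratedFDeriv ℝ i (h lam m) x‖ ≤ 1 + C := by
    intro lam hlam i hi hik m x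
    rw [hhd lam hlam i hi hik, norm_smul, Real.norm_of_nonneg (inv_nonneg.2 (ha0 m).le)]
    refine hweight _ _ _ (ha0 m) ?_
    rcases hi.eq_or_lt with rfl | hi2
    · rw [norm_iteratedFDeriv_one]
      refine (norm_fderiv_le_of_lip' ℝ (hc0 m)
        (Filter.Eventually.of_forall fun v => hlip lam hlam m v _)).trans ?_
      nlinarith [hc0 m, heps0 m, mul_pos hC (heps0 m), mul_nonneg hC.le (hc0 m)]
    · rw [hpart lam hlam i hik]
      refine (norm_compContinuousLinearMap_inr_le _).trans
        ((hfbound i hi2 hik m lam hlam _).trans ?_)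
      nlinarith [hc0 m, heps0 m, mul_pos hC (heps0 m), mul_nonneg hC.le (hc0 m)]
  have hTaylor := fun lam hlam => hasFTaylorSeriesUpTo_nemytskii (hhC lam hlam)
    (by positivity : (0 : ℝ) ≤ 1 + C) (hhb lam hlam) (hN lam hlam)
  have hNC : ∀ lam ∈ Sg, ContDiff ℝ (k : ℕ∞) (N lam) := fun lam hlam =>
    (hTaylor lam hlam).contDiff
  have hderiv : ∀ lam ∈ Sg, ∀ i : ℕ, i ≤ k → ∀ w, iteratedFDeriv ℝ i (fun w => Top lam w) w
      = S.compContinuousMultilinearMap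
          (pointwiseMultilinear (boundedFamily fun m => iteratedFDeriv ℝ i (h lam m) (w m))) := by
    intro lam hlam i hi w
    have hi' : ((i : ℕ) : WithTop ℕ∞) ≤ (k : ℕ∞) := by exact_mod_cast hi
    rw [hTopS lam hlam, S.iteratedFDeriv_comp_left (hNC lam hlam).contDiffAt hi',
      ← (hTaylor lam hlam).eq_iteratedFDeriv hi']
  have hfam : ∀ lam ∈ Sg, ∀ i : ℕ, 1 ≤ i → i ≤ k → ∀ (w : ℤ →ᵇ X) m,
      boundedFamily (fun m => iteratedFDeriv ℝ i (h lam m) (w m)) m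
        = (c m + eps m)⁻¹ • iteratedFDeriv ℝ i (f lam m) (y lam m + w m) := by
    intro lam hlam i hi hik w m
    rw [boundedFamily_apply fun m => hhb lam hlam i hi (by omega) m _,
      hhd lam hlam i hi (by omega)]
  refine ⟨Sg ×ˢ univ, hSg.prod isOpen_univ, fun p hp => ⟨hp.1, trivial⟩, subset_rfl,
    fun p hp => ?_, fun i hi hik => ⟨?_, fun p hp η n => ?_⟩⟩
  · rw [hTopS p.1 hp.1]
    exact (S.contDiff.comp (hNC p.1 hp.1)).contDiffAt
  · rintro ⟨lam₀, w₀⟩ ⟨hlam₀, -⟩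
    obtain ⟨M, hM1, S₀, hS₀, hS₀Sg, hMS⟩ := hM lam₀ hlam₀
    obtain ⟨r, hr, hball⟩ := Metric.mem_nhds_iff.1 hS₀
    have hmem₀ : lam₀ ∈ Metric.ball lam₀ r := Metric.mem_ball_self hr
    refine ContinuousAt.continuousWithinAt ?_
    have hlim : Filter.Tendsto (fun p : E × (ℤ →ᵇ X) =>
        ‖S‖ * (C * (‖p.1 - lam₀‖ + (M * ‖p.1 - lam₀‖ + ‖p.2 - w₀‖)))) (nhds (lam₀, w₀))
        (nhds 0) := by
      have hcont : Continuous (fun p : E × (ℤ →ᵇ X) =>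
        ‖S‖ * (C * (‖p.1 - lam₀‖ + (M * ‖p.1 - lam₀‖ + ‖p.2 - w₀‖)))) := by fun_prop
      simpa using hcont.tendsto (lam₀, w₀)
    refine tendsto_iff_norm_sub_tendsto_zero.2 (squeeze_zero' (Filter.Eventually.of_forall
      fun _ => norm_nonneg _) ?_ hlim)
    have hnear : ∀ᶠ p : E × (ℤ →ᵇ X) in nhds (lam₀, w₀), p.1 ∈ Metric.ball lam₀ r :=
      continuous_fst.continuousAt.eventually (Metric.ball_mem_nhds lam₀ hr)
    filter_upwards [hnear] with p hp
    have hpSg : p.1 ∈ Sg := hS₀Sg (hball hp)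
    rw [hderiv p.1 hpSg i hik, hderiv lam₀ hlam₀ i hik]
    have hsub : ∀ D D' : (ℤ →ᵇ X) [×i]→L[ℝ] (ℤ →ᵇ X),
        S.compContinuousMultilinearMap D - S.compContinuousMultilinearMap D'
          = S.compContinuousMultilinearMap (D - D') := fun D D' => by
      ext1 η
      exact (map_sub S _ _).symm
    rw [hsub]
    refine (S.norm_compContinuousMultilinearMap_le _).trans ?_
    gcongr
    refine norm_pointwiseMultilinear_sub_le (by positivity) fun m => ?_
    rw [hfam p.1 hpSg i hi hik, hfam lam₀ hlam₀ i hi hik, ← smul_sub, norm_smul,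
      Real.norm_of_nonneg (inv_nonneg.2 (ha0 m).le)]
    refine hweight _ _ _ (ha0 m) ?_
    rw [hpart p.1 hpSg i (by omega), hpart lam₀ hlam₀ i (by omega)]
    have hy : ‖y p.1 m - y lam₀ m‖ ≤ M * ‖p.1 - lam₀‖ :=
      Convex.norm_image_sub_le_of_norm_hasFDerivWithin_le (𝕜 := ℝ)
        (fun v hv => (((hyC m).differentiableOn (by simp) v
          (hS₀Sg (hball hv))).hasFDerivWithinAt).mono (hball.trans hS₀Sg))
        (fun v hv => by
          rw [← norm_iteratedFDerivWithin_one _ (hSg.uniqueDiffOn v (hS₀Sg (hball hv)))]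
          exact hMS v (hball hv) 1 le_rfl (by omega) m)
        (convex_ball lam₀ r) hmem₀ hp
    have hF := norm_iteratedFDerivWithin_sub_le hU (T := Metric.ball lam₀ r ×ˢ (univ : Set X))
      (prod_mono (hball.trans hS₀Sg) subset_rfl) ((convex_ball lam₀ r).prod convex_univ)
      (hfC m) (i := i) (by exact_mod_cast Nat.lt_succ_of_le hik) (B := C * eps m)
      (fun v hv => hfbound (i + 1) (by omega) (by omega) m v.1 (hS₀Sg (hball hv.1)) v.2)
      (x := (p.1, y p.1 m + p.2 m)) (x' := (lam₀, y lam₀ m + w₀ m))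
      ⟨hp, trivial⟩ ⟨hmem₀, trivial⟩
    have hw : ‖p.2 m - w₀ m‖ ≤ ‖p.2 - w₀‖ := (p.2 - w₀).norm_coe_le_norm m
    have hdist : ‖((p.1, y p.1 m + p.2 m) : E × X) - (lam₀, y lam₀ m + w₀ m)‖
        ≤ ‖p.1 - lam₀‖ + (M * ‖p.1 - lam₀‖ + ‖p.2 - w₀‖) := by
      rw [Prod.mk_sub_mk, Prod.norm_mk, add_sub_add_comm]
      refine (max_le_add_of_nonneg (norm_nonneg _) (norm_nonneg _)).trans ?_
      gcongr
      exact (norm_add_le _ _).trans (add_le_add hy hw)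
    refine (norm_compContinuousLinearMap_inr_le (_ - _)).trans (hF.trans ?_)
    calc C * eps m * ‖((p.1, y p.1 m + p.2 m) : E × X) - (lam₀, y lam₀ m + w₀ m)‖
        ≤ C * (c m + eps m) * (‖p.1 - lam₀‖ + (M * ‖p.1 - lam₀‖ + ‖p.2 - w₀‖)) := by
          have := heps0 m
          have := hc0 m
          gcongr
          linarith
      _ = _ := by ring
  · rw [hderiv p.1 hp.1 i hik]
    change S (pointwiseMultilinear _ η) n = _
    rw [hS]
    refine tsum_congr fun j => ?_
    rw [pointwiseMultilinear_apply, hfam p.1 hp.1 i hi hik]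
    simp only [smul_apply, map_smul]
    rw [smul_smul, inv_mul_cancel₀ (ha0 _).ne', one_smul]
end
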